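/- Let G be a group of F-type and suppose the amalgamated subgroup ⟨U⟩ = ⟨V⟩ is malnormal in G. Then every two-generator subgroup of G is a free product of cyclic groups, and the rank of G (the minimal number of generators of G) is at least 3. -/

import Mathlib

open scoped MatrixGroups

namespace FPaper

/-- A (reduced) word in a free group is *cyclically reduced* if its first letter is not the
formal inverse of its last letter. -/
def CyclicallyReduced {α : Type*} [DecidableEq α] (w : FreeGroup α) : Prop :=
  ∀ x y : α × Bool, w.toWord.head? = some x → w.toWord.getLast? = some y →
    x.1 = y.1 → x.2 = y.2

/-- The combinatorial data of a presentation of F-type: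
`⟨a_1, …, a_n ∣ a_1^{e_1} = ⋯ = a_n^{e_n} = U V = 1⟩` with
`U = U(a_1, …, a_p)` and `V = V(a_{p+1}, …, a_n)`. -/
structure FTypeBase where
  n : ℕ
  e : Fin n → ℕ
  p : ℕ
  U : FreeGroup (Fin n)
  V : FreeGroup (Fin n)

namespace FTypeBase

/-- Relators of the full F-type presentation. -/
def rels (D : FTypeBase) : Set (FreeGroup (Fin D.n)) :=
  {w | ∃ i : Fin D.n, w = FreeGroup.of i ^ D.e i} ∪ {D.U * D.V}

/-- Relators presenting the first factor `G₁` (the generators `a_{p+1}, …, a_n` are killed), so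
that `PresentedGroup D.rels1` is the free product of cyclics on `a_1, …, a_p`. -/
def rels1 (D : FTypeBase) : Set (FreeGroup (Fin D.n)) :=
  {w | ∃ i : Fin D.n, (i : ℕ) < D.p ∧ w = FreeGroup.of i ^ D.e i} ∪
    {w | ∃ i : Fin D.n, D.p ≤ (i : ℕ) ∧ w = FreeGroup.of i}

/-- Relators presenting the second factor `G₂` (the generators `a_1, …, a_p` are killed), so
that `PresentedGroup D.rels2` is the free product of cyclics on `a_{p+1}, …, a_n`. -/
def rels2 (D : FTypeBase) : Set (FreeGroup (Fin D.n)) :=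
  {w | ∃ i : Fin D.n, D.p ≤ (i : ℕ) ∧ w = FreeGroup.of i ^ D.e i} ∪
    {w | ∃ i : Fin D.n, (i : ℕ) < D.p ∧ w = FreeGroup.of i}

/-- The group presented by the F-type presentation. -/
abbrev Gp (D : FTypeBase) := PresentedGroup D.rels

/-- The first factor `G₁ = ⟨a_1, …, a_p ∣ a_1^{e_1} = ⋯ = a_p^{e_p} = 1⟩`. -/
abbrev Gp1 (D : FTypeBase) := PresentedGroup D.rels1

/-- The second factor `G₂ = ⟨a_{p+1}, …, a_n ∣ a_{p+1}^{e_{p+1}} = ⋯ = a_n^{e_n} = 1⟩`. -/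
abbrev Gp2 (D : FTypeBase) := PresentedGroup D.rels2

/-- The image of the word `U` in the first factor `G₁`. -/
def imgU1 (D : FTypeBase) : D.Gp1 := PresentedGroup.mk D.rels1 D.U

/-- The image of the word `V` in the second factor `G₂`. -/
def imgV2 (D : FTypeBase) : D.Gp2 := PresentedGroup.mk D.rels2 D.V

/-- The conditions making an F-type presentation: `n ≥ 2`; each `e_i` is `0` or `≥ 2`;
`1 ≤ p ≤ n - 1`; `U` is a cyclically reduced word in `a_1, …, a_p` of infinite order in `G₁`;
`V` is a cyclically reduced word in `a_{p+1}, …, a_n` of infinite order in `G₂`; and if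
`p = 1` (resp. `p = n - 1`) then `U = a_1^m` (resp. `V = a_n^m`) for some `m ≥ 2`. -/
def IsFType (D : FTypeBase) : Prop :=
  2 ≤ D.n ∧ (∀ i, D.e i = 0 ∨ 2 ≤ D.e i) ∧ 1 ≤ D.p ∧ D.p ≤ D.n - 1 ∧
  (∀ x ∈ D.U.toWord, (x.1 : ℕ) < D.p) ∧ (∀ x ∈ D.V.toWord, D.p ≤ (x.1 : ℕ)) ∧
  CyclicallyReduced D.U ∧ CyclicallyReduced D.V ∧
  ¬ IsOfFinOrder D.imgU1 ∧ ¬ IsOfFinOrder D.imgV2 ∧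
  (D.p = 1 → ∃ (i : Fin D.n) (m : ℕ), (i : ℕ) = 0 ∧ 2 ≤ m ∧ D.U = FreeGroup.of i ^ m) ∧
  (D.p = D.n - 1 → ∃ (i : Fin D.n) (m : ℕ), (i : ℕ) = D.n - 1 ∧ 2 ≤ m ∧ D.V = FreeGroup.of i ^ m)

/-- The subgroup of the F-type group generated by (the images of) `a_1, …, a_p`. -/
def factor1 (D : FTypeBase) : Subgroup D.Gp :=
  Subgroup.closure {g | ∃ i : Fin D.n, (i : ℕ) < D.p ∧ g = PresentedGroup.of i}

/-- The subgroup of the F-type group generated by (the images of) `a_{p+1}, …, a_n`. -/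
def factor2 (D : FTypeBase) : Subgroup D.Gp :=
  Subgroup.closure {g | ∃ i : Fin D.n, D.p ≤ (i : ℕ) ∧ g = PresentedGroup.of i}

/-- The amalgamated subgroup `A = ⟨U⟩ = ⟨V⟩` of the F-type group. -/
def amalg (D : FTypeBase) : Subgroup D.Gp :=
  Subgroup.zpowers (PresentedGroup.mk D.rels D.U)

end FTypeBase

/-- A group is *of F-type* if it is isomorphic to the group of some F-type presentation. -/
def IsFTypeGroup (G : Type*) [Group G] : Prop :=
  ∃ D : FTypeBase, D.IsFType ∧ Nonempty (G ≃* D.Gp)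

/-- An element of a group is a *proper power* if it equals `h ^ k` for some `k ≥ 2`. -/
def IsProperPower {G : Type*} [Group G] (g : G) : Prop :=
  ∃ (h : G) (k : ℕ), 2 ≤ k ∧ g = h ^ k

/-- A group is a *free product of cyclic groups* if it has a presentation in which every
relator is a power of a generator. -/
def IsFreeProductOfCyclics (H : Type*) [Group H] : Prop :=
  ∃ (ι : Type) (e : ι → ℕ),
    Nonempty (H ≃* PresentedGroup {w : FreeGroup ι | ∃ i : ι, w = FreeGroup.of i ^ e i})

/-- A subgroup `K` of `H` is *malnormal* if `g K g⁻¹ ∩ K = {1}` for every `g ∉ K`. -/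
def IsMalnormal {H : Type*} [Group H] (K : Subgroup H) : Prop :=
  ∀ g : H, g ∉ K → ∀ x ∈ K, g * x * g⁻¹ ∈ K → x = 1

end FPaper

namespace FPaper

/-- An action of a group on (the vertices of) a simplicial tree, recorded by the path metric of the
tree, without inversions and such that a nontrivial element fixes at most one edge at any vertex. -/
structure TreeAction (G V : Type*) [Group G] [MulAction G V] where
  d : V → V → ℕ
  d_eq_zero : ∀ {u v}, d u v = 0 ↔ u = v
  d_comm : ∀ u v, d u v = d v u
  step : ∀ {v w} u, d v w = 1 → d w u = d v u + 1 ∨ d w u + 1 = d v u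
  exists_next : ∀ {v u}, v ≠ u → ∃ w, d v w = 1 ∧ d w u + 1 = d v u
  next_unique : ∀ {v u w w'}, d v w = 1 → d v w' = 1 → d w u + 1 = d v u → d w' u + 1 = d v u →
    w = w'
  d_smul : ∀ (g : G) u v, d (g • u) (g • v) = d u v
  d_smul_ne_one : ∀ (g : G) v, d v (g • v) ≠ 1
  eq_one_of_fix : ∀ {g : G} {v w w'}, d v w = 1 → d v w' = 1 → w ≠ w' → g • v = v → g • w = w →
    g • w' = w' → g = 1

namespace TreeAction

variable {G V : Type*} [Group G] [MulAction G V] (τ : TreeAction G V)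

/-- The half-tree of the vertices that are closer to `w` than to `v`. -/
def half (v w : V) : Set V := {u | τ.d w u + 1 = τ.d v u}

/-- `w` is the neighbour of `v` in the direction of `u`. -/
def Next (v u w : V) : Prop := τ.d v w = 1 ∧ u ∈ τ.half v w

variable {τ} {u v w w' a b c s t : V} {g x y : G}

theorem d_self : τ.d v v = 0 := τ.d_eq_zero.2 rfl

theorem mem_half : u ∈ τ.half v w ↔ τ.d w u + 1 = τ.d v u := Iff.rfl

theorem notMem_half_self : v ∉ τ.half v w := by
  simp [mem_half, d_self]

theorem mem_half_smul : g • u ∈ τ.half (g • v) (g • w) ↔ u ∈ τ.half v w := by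
  simp [mem_half, τ.d_smul]

theorem compl_half (h : τ.d v w = 1) : (τ.half v w)ᶜ = τ.half w v := by
  ext u
  have := τ.step u h
  simp only [Set.mem_compl_iff, mem_half]
  omega

theorem disjoint_half (h : τ.d v w = 1) (h' : τ.d v w' = 1) (hne : w ≠ w') :
    Disjoint (τ.half v w) (τ.half v w') :=
  Set.disjoint_left.2 fun _ hu hu' => hne (τ.next_unique h h' hu hu')

theorem half_subset_of_ne (h : τ.d v w = 1) (h' : τ.d v w' = 1) (hne : w ≠ w') :
    τ.half v w ⊆ τ.half w' v := by
  rw [← compl_half h']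
  exact (disjoint_half h h' hne).subset_compl_right

theorem d_triangle (u v w : V) : τ.d u w ≤ τ.d u v + τ.d v w := by
  induction h : τ.d u v generalizing u with
  | zero => rw [τ.d_eq_zero.1 h]; omega
  | succ n ih =>
    obtain ⟨u', h1, h2⟩ := τ.exists_next (v := u) (u := v) (by rintro rfl; simp [d_self] at h)
    have := ih u' (by omega)
    have := τ.step w h1
    omega

theorem exists_Next (h : v ≠ u) : ∃ w, τ.Next v u w := τ.exists_next h

theorem Next.unique (h : τ.Next v u w) (h' : τ.Next v u w') : w = w' :=
  τ.next_unique h.1 h'.1 h.2 h'.2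

theorem Next.ne (h : τ.Next v u w) : v ≠ u := by
  rintro rfl; exact notMem_half_self h.2

theorem Next.smul (h : τ.Next v u w) (g : G) : τ.Next (g • v) (g • u) (g • w) :=
  ⟨by rw [τ.d_smul]; exact h.1, mem_half_smul.2 h.2⟩

/-- A geodesic from `v` to `c` through `b ≠ v` starts in the direction of `b`. -/
theorem Next.of_between (h : τ.Next v b w) (hb : τ.d v b + τ.d b c = τ.d v c) :
    τ.Next v c w := by
  refine ⟨h.1, ?_⟩
  have h1 := mem_half.1 h.2
  have := d_triangle (τ := τ) w b c
  have := τ.step c h.1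
  rw [mem_half]
  omega

theorem half_subset_half (hst : τ.d s t = 1) (hg : τ.d v s + 1 + τ.d t a = τ.d v a)
    (hw : τ.Next v a w) : τ.half s t ⊆ τ.half v w := by
  induction hn : τ.d v s generalizing v w with
  | zero =>
    obtain rfl := τ.d_eq_zero.1 hn
    rw [τ.next_unique hst hw.1 (by omega) hw.2]
  | succ n ih =>
    obtain ⟨w', hw'⟩ := exists_Next (τ := τ) (v := v) (u := s) (by rintro rfl; simp [d_self] at hn)
    have hsa : τ.d s a = 1 + τ.d t a := by
      have h1 := d_triangle (τ := τ) v s a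
      have := τ.step a hst
      omega
    obtain rfl := (hw'.of_between (by omega)).unique hw
    have h1 := mem_half.1 hw'.2
    have h2 := mem_half.1 hw.2
    obtain ⟨z, hz⟩ := exists_Next (τ := τ) (v := w') (u := a)
      (by
        rintro rfl
        have : τ.d w' w' = 0 := d_self
        omega)
    have h3 := mem_half.1 hz.2
    refine (ih (by omega) hz (by omega)).trans (half_subset_of_ne hz.1 ?_ ?_)
    · rw [τ.d_comm]; exact hw.1
    · rintro rfl; omega

theorem d_eq_add_of_Next_ne (ha : τ.Next v a s) (hc : τ.Next v c t) (hne : s ≠ t) :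
    τ.d a c = τ.d a v + τ.d v c := by
  induction hn : τ.d a v generalizing a with
  | zero => rw [τ.d_eq_zero.1 hn]; omega
  | succ n ih =>
    obtain ⟨a', ha'⟩ := exists_Next (τ := τ) ha.ne.symm
    have h1 := mem_half.1 ha'.2
    have hca : c ∈ τ.half a a' := by
      rw [← compl_half (by rw [τ.d_comm]; exact ha'.1)]
      intro hmem
      have hsub : τ.half a' a ⊆ τ.half v s := by
        refine half_subset_half (a := a) (by rw [τ.d_comm]; exact ha'.1) ?_ ha
        rw [d_self, τ.d_comm v, τ.d_comm v]; omega
      exact Set.disjoint_left.1 (disjoint_half ha.1 hc.1 hne) (hsub hmem) hc.2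
    have h2 := mem_half.1 hca
    by_cases hv : v = a'
    · subst hv
      have : τ.d v v = 0 := d_self
      omega
    · obtain ⟨s', hs'⟩ := exists_Next (τ := τ) hv
      have h3 : τ.Next v a s' := hs'.of_between (by
        have := ha'.1
        have := τ.d_comm v a'
        have := τ.d_comm a' a
        have := τ.d_comm v a
        omega)
      obtain rfl := h3.unique ha
      have := ih hs' (by omega)
      omega

theorem Next_ne_of_between (ha : τ.Next v a s) (hc : τ.Next v c t)
    (h : τ.d a v + τ.d v c = τ.d a c) : s ≠ t := by
  rintro rfl
  have h1 := mem_half.1 ha.2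
  have h2 := mem_half.1 hc.2
  have := d_triangle (τ := τ) a s c
  rw [τ.d_comm a v] at h
  rw [τ.d_comm a s] at this
  omega

theorem exists_median (τ : TreeAction G V) (v a c : V) : ∃ b, τ.d v b + τ.d b a = τ.d v a ∧
    τ.d v b + τ.d b c = τ.d v c ∧ τ.d a b + τ.d b c = τ.d a c := by
  induction hn : τ.d v a generalizing v with
  | zero => exact ⟨v, by simp [d_self, hn], by simp [d_self], by rw [τ.d_eq_zero.1 hn]; simp [d_self]⟩
  | succ n ih =>
    obtain ⟨s, hs⟩ := exists_Next (τ := τ) (v := v) (u := a) (by rintro rfl; simp [d_self] at hn)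
    by_cases hvc : v = c
    · subst hvc
      exact ⟨v, by simp [d_self, hn], by simp [d_self], by simp [d_self]⟩
    obtain ⟨t, ht⟩ := exists_Next (τ := τ) hvc
    by_cases hst : s = t
    · subst hst
      have h1 := mem_half.1 hs.2
      have h2 := mem_half.1 ht.2
      obtain ⟨b, hb1, hb2, hb3⟩ := ih s (by omega)
      have h3 := d_triangle (τ := τ) v s b
      have h4 := d_triangle (τ := τ) v b a
      rw [hs.1] at h3
      exact ⟨b, by omega, by omega, hb3⟩
    · exact ⟨v, by simp [d_self, hn], by simp [d_self], (d_eq_add_of_Next_ne hs ht hst).symm⟩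

end TreeAction

section PingPong

variable {G V : Type*} [Group G] [MulAction G V]

/-- The nontrivial powers of `x` move `Y` off itself, and the `x`-orbit of `p` avoids `Y`. -/
def Wanders (x : G) (Y : Set V) (p : V) : Prop :=
  (∀ k : ℤ, x ^ k ≠ 1 → ∀ u ∈ Y, x ^ k • u ∉ Y) ∧ ∀ k : ℤ, x ^ k • p ∉ Y

/-- The nontrivial powers of `y` map the complement of `Y` into `Y`. -/
def IsAbsorbing (y : G) (Y : Set V) : Prop :=
  ∀ k : ℤ, y ^ k ≠ 1 → ∀ u ∉ Y, y ^ k • u ∈ Y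

/-- The element `x` maps the complement of `C` onto `D`. -/
def IsSchottky (x : G) (C D : Set V) : Prop :=
  ∀ u, x • u ∈ D ↔ u ∉ C

variable {x y : G} {Y Y' C D : Set V} {p : V}

theorem Wanders.mono (h : Wanders x Y p) (hY : Y' ⊆ Y) : Wanders x Y' p :=
  ⟨fun k hk u hu hu' => h.1 k hk u (hY hu) (hY hu'), fun k hk => h.2 k (hY hk)⟩

theorem Wanders.isAbsorbing (h : Wanders x Y p) (hY : Y' = Yᶜ) : IsAbsorbing x Y' := by
  subst hY
  intro k hk u hu
  exact h.1 k hk u (by simpa using hu)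

theorem IsSchottky.pow_smul_mem (h : IsSchottky x C D) (hCD : Disjoint C D) (n : ℕ) {u : V}
    (hu : u ∉ C) : x ^ (n + 1) • u ∈ D := by
  induction n with
  | zero => simpa using (h u).2 hu
  | succ n ih =>
    rw [pow_succ', mul_smul]
    exact (h _).2 (Set.disjoint_right.1 hCD ih)

theorem IsSchottky.inv (h : IsSchottky x C D) : IsSchottky x⁻¹ D C := by
  intro u
  have := h (x⁻¹ • u)
  rw [smul_inv_smul] at this
  tauto

theorem IsSchottky.zpow_smul_mem (h : IsSchottky x C D) (hCD : Disjoint C D) {k : ℤ} (hk : k ≠ 0)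
    {u : V} (hC : u ∉ C) (hD : u ∉ D) : x ^ k • u ∈ C ∪ D := by
  obtain ⟨n, rfl | rfl⟩ := k.eq_nat_or_neg
  · obtain ⟨n, rfl⟩ := Nat.exists_eq_succ_of_ne_zero (n := n) (by rintro rfl; simp at hk)
    right
    rw [zpow_natCast]
    exact h.pow_smul_mem hCD n hC
  · obtain ⟨n, rfl⟩ := Nat.exists_eq_succ_of_ne_zero (n := n) (by rintro rfl; simp at hk)
    left
    have := h.inv.pow_smul_mem hCD.symm n hD
    rw [zpow_neg, zpow_natCast, ← inv_pow]
    exact this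

theorem IsSchottky.wanders (h : IsSchottky x C D) (hCD : Disjoint C D) (hC : Disjoint Y C)
    (hD : Disjoint Y D) (hpY : p ∉ Y) (hpC : p ∉ C) (hpD : p ∉ D) : Wanders x Y p := by
  have key : ∀ {k : ℤ}, k ≠ 0 → ∀ {u : V}, u ∉ C → u ∉ D → x ^ k • u ∉ Y := by
    intro k hk u h1 h2 h3
    rcases h.zpow_smul_mem hCD hk h1 h2 with h4 | h4
    · exact Set.disjoint_left.1 hC h3 h4
    · exact Set.disjoint_left.1 hD h3 h4
  refine ⟨fun k hk u hu => key (by rintro rfl; simp at hk) (Set.disjoint_left.1 hC hu)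
    (Set.disjoint_left.1 hD hu), fun k => ?_⟩
  by_cases hk : k = 0
  · simpa [hk] using hpY
  · exact key hk hpC hpD

theorem IsSchottky.isAbsorbing (h : IsSchottky x C D) (hCD : Disjoint C D) : IsAbsorbing x (C ∪ D) := by
  intro k hk u hu
  rw [Set.mem_union, not_or] at hu
  exact h.zpow_smul_mem hCD (by rintro rfl; simp at hk) hu.1 hu.2

/-- Ping-pong data for the pair `x`, `y` and a base point `p`. -/
def IsPingPong (x y : G) (p : V) : Prop :=
  ∃ Y : Set V, Wanders x Y p ∧ IsAbsorbing y Y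

/-- The subgroup `H` has a generating pair in ping-pong position. -/
def HasPingPong (V : Type*) [MulAction G V] (H : Subgroup G) : Prop :=
  ∃ (x y : G) (p : V), Subgroup.closure {x, y} = H ∧ IsPingPong x y p

end PingPong

namespace TreeAction

variable {G V : Type*} [Group G] [MulAction G V] {τ : TreeAction G V}
  {u v w w' a b c s t p : V} {g x y : G}

theorem isSchottky_half (x : G) (h : τ.d s t = 1) :
    IsSchottky x (τ.half s t) (τ.half (x • t) (x • s)) := by
  intro u
  rw [mem_half_smul, ← compl_half h, Set.mem_compl_iff]

theorem zpow_smul_eq (hv : x • v = v) (k : ℤ) : x ^ k • v = v := by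
  have : x ∈ MulAction.stabilizer G v := hv
  exact (MulAction.stabilizer G v).zpow_mem this k

theorem d_zpow_smul (hv : x • v = v) (h : τ.d v w = 1) (k : ℤ) : τ.d v (x ^ k • w) = 1 := by
  rw [← h, ← τ.d_smul (x ^ k) v w, zpow_smul_eq hv]

theorem smul_eq_of_zpow_smul_eq (h : τ.d v w = 1) (hv : x • v = v) {k : ℤ} (hk : x ^ k ≠ 1)
    (hw : x ^ k • w = w) : x • w = w := by
  by_contra hne
  refine hk (τ.eq_one_of_fix (w' := x • w) h ?_ (Ne.symm hne) (zpow_smul_eq hv k) hw ?_)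
  · simpa using d_zpow_smul hv h 1
  · rw [← mul_smul, ((Commute.refl x).zpow_left k).eq, mul_smul, hw]

theorem d_inv_smul (x : G) (v : V) : τ.d v (x⁻¹ • v) = τ.d v (x • v) := by
  rw [← τ.d_smul x, smul_inv_smul, τ.d_comm]

theorem inv_smul_ne (h : x • v ≠ v) : v ≠ x⁻¹ • v := fun h' => h (by
  conv_lhs => rw [h']
  rw [smul_inv_smul])

theorem wanders_half_of_fix (h : τ.d v w = 1) (hv : x • v = v) (hw : x • w ≠ w) :
    Wanders x (τ.half v w) v := by
  refine ⟨fun k hk u hu => ?_, fun k => ?_⟩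
  · have hne : w ≠ x ^ k • w := fun h' => hw (smul_eq_of_zpow_smul_eq h hv hk h'.symm)
    have : x ^ k • u ∈ τ.half (x ^ k • v) (x ^ k • w) := mem_half_smul.2 hu
    rw [zpow_smul_eq hv] at this
    exact Set.disjoint_right.1 (disjoint_half h (d_zpow_smul hv h k) hne) this
  · rw [zpow_smul_eq hv]
    exact notMem_half_self

/-- If the geodesics from `v` to `x • v` and `x⁻¹ • v` both start towards `w`, then `w` is moved
by two units less. -/
theorem d_smul_of_Next (h : τ.Next v (x • v) w) (h' : τ.Next v (x⁻¹ • v) w) :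
    τ.d w (x • w) + 2 = τ.d v (x • v) := by
  have h1 := mem_half.1 h.2
  have h2 := h'.smul x
  rw [smul_inv_smul] at h2
  have h3 := τ.d_smul_ne_one x v
  have hne : x • v ≠ w := by
    rintro rfl
    rw [d_self] at h1
    omega
  obtain ⟨t, ht⟩ := exists_Next (τ := τ) hne
  have h4 : τ.Next (x • v) v t := ht.of_between (by
    rw [τ.d_comm _ w, τ.d_comm w v, h.1, τ.d_comm _ v]; omega)
  obtain rfl := h4.unique h2
  have h5 := mem_half.1 ht.2
  rw [τ.d_comm (x • v), τ.d_comm (x • w)] at h5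
  omega

theorem half_smul_subset (h' : τ.Next v (x⁻¹ • v) b) (h : τ.Next v (x • v) a) :
    τ.half (x • b) (x • v) ⊆ τ.half v a := by
  have h1 := mem_half.1 (h'.smul x).2
  rw [smul_inv_smul] at h1
  refine half_subset_half (a := x • v) ?_ ?_ h
  · rw [τ.d_smul, τ.d_comm]; exact h'.1
  · rw [d_self, τ.d_comm v, τ.d_comm v]; omega

theorem notMem_half_of_Next (hx : x • v ≠ v) (h : τ.Next v (x • v) w)
    (h' : τ.Next v (x⁻¹ • v) w) :
    τ.d w v = 1 ∧ (x • w = w → x • v ≠ v) ∧ x • w ∉ τ.half w v ∧ x⁻¹ • w ∉ τ.half w v := by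
  have h0 := d_smul_of_Next h h'
  have h1 := mem_half.1 h.2
  have h2 := mem_half.1 h'.2
  refine ⟨by rw [τ.d_comm]; exact h.1, fun _ => hx, fun hm => ?_, fun hm => ?_⟩
  · have h3 := mem_half.1 hm
    have h4 := d_triangle (τ := τ) v (x • w) (x • v)
    rw [τ.d_smul, τ.d_comm w v, h.1] at h4
    omega
  · have h3 := mem_half.1 hm
    rw [d_inv_smul, ← τ.d_smul x v, smul_inv_smul, τ.d_comm] at h3
    omega

theorem exists_wanders_half (h : τ.d v w = 1) (hf : x • v = v → x • w ≠ w)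
    (h1 : x • v ∉ τ.half v w) (h2 : x⁻¹ • v ∉ τ.half v w) :
    ∃ p, Wanders x (τ.half v w) p := by
  induction hn : τ.d v (x • v) using Nat.strong_induction_on generalizing v w with
  | _ n ih =>
  by_cases hv : x • v = v
  · exact ⟨v, wanders_half_of_fix h hv (hf hv)⟩
  obtain ⟨a, ha⟩ := exists_Next (τ := τ) (Ne.symm hv)
  obtain ⟨b, hb⟩ := exists_Next (τ := τ) (inv_smul_ne hv)
  have hwa : w ≠ a := by rintro rfl; exact h1 ha.2
  have hwb : w ≠ b := by rintro rfl; exact h2 hb.2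
  by_cases hab : a = b
  · subst hab
    obtain ⟨e1, e2, e3, e4⟩ := notMem_half_of_Next hv ha hb
    obtain ⟨p, hp⟩ := ih _ (by have := d_smul_of_Next ha hb; omega) e1 e2 e3 e4 rfl
    exact ⟨p, hp.mono (half_subset_of_ne h ha.1 hwa)⟩
  · have hsub := half_smul_subset hb ha
    exact ⟨v, (isSchottky_half x hb.1).wanders
      ((disjoint_half hb.1 ha.1 (Ne.symm hab)).mono_right hsub) (disjoint_half h hb.1 hwb)
      ((disjoint_half h ha.1 hwa).mono_right hsub) notMem_half_self notMem_half_self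
      fun hm => notMem_half_self (hsub hm)⟩

theorem exists_wanders_half_of_Next (hx : x • v ≠ v) (h : τ.Next v (x • v) w)
    (h' : τ.Next v (x⁻¹ • v) w) : ∃ p, Wanders x (τ.half w v) p := by
  obtain ⟨e1, e2, e3, e4⟩ := notMem_half_of_Next hx h h'
  exact exists_wanders_half e1 e2 e3 e4

/-- The pair `x`, `y` generates `H` and the sum of the displacements of `v` under `x` and `y` is
minimal among all generating pairs of `H` and all vertices. -/
def IsMinimal (τ : TreeAction G V) (H : Subgroup G) (x y : G) (v : V) : Prop :=
  Subgroup.closure {x, y} = H ∧ ∀ x' y' v', Subgroup.closure {x', y'} = H →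
    τ.d v (x • v) + τ.d v (y • v) ≤ τ.d v' (x' • v') + τ.d v' (y' • v')

section Closure

theorem closure_pair_inv_left (x y : G) : Subgroup.closure {x⁻¹, y} = Subgroup.closure {x, y} := by
  apply le_antisymm <;> rw [Subgroup.closure_le] <;> rintro z (rfl | rfl)
  · exact inv_mem (Subgroup.subset_closure (by simp))
  · exact Subgroup.subset_closure (by simp)
  · have : z⁻¹ ∈ Subgroup.closure {z⁻¹, y} := Subgroup.subset_closure (by simp)
    simpa using inv_mem this
  · exact Subgroup.subset_closure (by simp)

theorem closure_pair_mul_zpow (x y : G) (k : ℤ) :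
    Subgroup.closure {x, y * x ^ k} = Subgroup.closure {x, y} := by
  have hx : ∀ z : G, x ∈ Subgroup.closure {x, z} := fun z => Subgroup.subset_closure (by simp)
  have hz : ∀ z : G, z ∈ Subgroup.closure {x, z} := fun z => Subgroup.subset_closure (by simp)
  apply le_antisymm <;> rw [Subgroup.closure_le] <;> rintro z (rfl | rfl)
  · exact hx _
  · exact mul_mem (hz _) (zpow_mem (hx _) k)
  · exact hx _
  · have := mul_mem (hz (z * x ^ k)) (zpow_mem (hx (z * x ^ k)) (-k))
    simpa using this

end Closure

variable {H : Subgroup G}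

theorem exists_isMinimal (τ : TreeAction G V) (v : V) (x y : G) :
    ∃ x' y' v', τ.IsMinimal (Subgroup.closure {x, y}) x' y' v' := by
  classical
  let P : ℕ → Prop := fun n => ∃ x' y' v', Subgroup.closure {x', y'} = Subgroup.closure {x, y} ∧
    τ.d v' (x' • v') + τ.d v' (y' • v') = n
  have hP : ∃ n, P n := ⟨_, x, y, v, rfl, rfl⟩
  obtain ⟨x', y', v', h1, h2⟩ := Nat.find_spec hP
  refine ⟨x', y', v', h1, fun x'' y'' v'' h => ?_⟩
  rw [h2]
  exact Nat.find_min' hP ⟨x'', y'', v'', h, rfl⟩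

theorem IsMinimal.swap (h : τ.IsMinimal H x y v) : τ.IsMinimal H y x v := by
  refine ⟨by rw [Set.pair_comm]; exact h.1, fun x' y' v' h' => ?_⟩
  rw [add_comm]
  exact h.2 x' y' v' h'

theorem IsMinimal.inv_left (h : τ.IsMinimal H x y v) : τ.IsMinimal H x⁻¹ y v := by
  refine ⟨by rw [closure_pair_inv_left]; exact h.1, fun x' y' v' h' => ?_⟩
  rw [d_inv_smul]
  exact h.2 x' y' v' h'

theorem IsMinimal.inv_right (h : τ.IsMinimal H x y v) : τ.IsMinimal H x y⁻¹ v :=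
  h.swap.inv_left.swap

theorem IsMinimal.mul_zpow (h : τ.IsMinimal H x y v) (hv : x • v = v) (k : ℤ) :
    τ.IsMinimal H x (y * x ^ k) v := by
  refine ⟨by rw [closure_pair_mul_zpow]; exact h.1, fun x' y' v' h' => ?_⟩
  rw [mul_smul, zpow_smul_eq hv]
  exact h.2 x' y' v' h'

theorem IsMinimal.of_le (h : τ.IsMinimal H x y v)
    (hw : τ.d w (x • w) + τ.d w (y • w) ≤ τ.d v (x • v) + τ.d v (y • v)) :
    τ.IsMinimal H x y w :=
  ⟨h.1, fun x' y' v' h' => hw.trans (h.2 x' y' v' h')⟩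

/-- Minimality bounds the overlap of the geodesics to `x • v` and `y • v`. -/
theorem IsMinimal.le_d (h : τ.IsMinimal H x y v) : τ.d v (y • v) ≤ τ.d (x • v) (y • v) := by
  have h1 := h.2 x (y⁻¹ * x) v (by
    have := closure_pair_mul_zpow x y⁻¹ 1
    rw [zpow_one] at this
    rw [this, Set.pair_comm, closure_pair_inv_left, Set.pair_comm]
    exact h.1)
  rw [mul_smul, ← τ.d_smul y v (y⁻¹ • x • v), smul_inv_smul, τ.d_comm (y • v)] at h1
  omega

/-- The case in which `x` fixes `v` and the two directions of `y` at `v` are not equivalent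
under `x`. -/
theorem isPingPong_of_fix_aux (hx : x • v = v) (ha : τ.Next v (y • v) a)
    (hb : τ.Next v (y⁻¹ • v) b) (hab : ∀ k : ℤ, x ^ k • a ≠ b)
    (hfix : ∀ k : ℤ, x ^ k ≠ 1 → x ^ k • b ≠ b) : IsPingPong x y v := by
  have hne : a ≠ b := by simpa using hab 0
  have hsub := half_smul_subset hb ha
  have hS := isSchottky_half y hb.1
  have hdis := (disjoint_half hb.1 ha.1 hne.symm).mono_right hsub
  refine ⟨_, ⟨fun k hk u hu => ?_, fun k => ?_⟩, hS.isAbsorbing hdis⟩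
  · have hB : ∀ u ∈ τ.half v b, ∀ j : ℤ, x ^ j • u ∈ τ.half v (x ^ j • b) := by
      intro u hu j
      have : x ^ j • u ∈ τ.half (x ^ j • v) (x ^ j • b) := mem_half_smul.2 hu
      rwa [zpow_smul_eq hx] at this
    have hA : ∀ u ∈ τ.half v a, ∀ j : ℤ, x ^ j • u ∈ τ.half v (x ^ j • a) := by
      intro u hu j
      have : x ^ j • u ∈ τ.half (x ^ j • v) (x ^ j • a) := mem_half_smul.2 hu
      rwa [zpow_smul_eq hx] at this
    have hAB : ∀ u ∈ τ.half v a, ∀ j : ℤ, x ^ j • u ∉ τ.half v b := fun u hu j =>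
      Set.disjoint_left.1 (disjoint_half (d_zpow_smul hx ha.1 j) hb.1 (hab j)) (hA u hu j)
    rintro (h1 | h1)
    · rcases hu with h2 | h2
      · exact Set.disjoint_left.1 (disjoint_half (d_zpow_smul hx hb.1 k) hb.1 (hfix k hk))
          (hB u h2 k) h1
      · exact hAB u (hsub h2) k h1
    · rcases hu with h2 | h2
      · refine hAB _ (hsub h1) (-k) ?_
        rw [← mul_smul, ← zpow_add, neg_add_cancel, zpow_zero, one_smul]
        exact h2
      · by_cases hka : x ^ k • a = a
        · have hay : a ≠ y • v := by
            rintro rfl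
            exact τ.d_smul_ne_one y v ha.1
          obtain ⟨c, hc⟩ := exists_Next (τ := τ) hay
          have hlen := mem_half.1 ha.2
          have hlen2 := mem_half.1 hc.2
          have hlen3 := mem_half.1 (hb.smul y).2
          rw [smul_inv_smul] at hlen3
          have hav : τ.d a v = 1 := by rw [τ.d_comm]; exact ha.1
          have hyb : τ.d (y • b) a + 2 = τ.d v (y • v) := by
            obtain ⟨t, ht⟩ := exists_Next (τ := τ) hay.symm
            have hbt := hb.smul y
            rw [smul_inv_smul] at hbt
            have : t = y • b := (ht.of_between (by
              rw [hav, τ.d_comm _ v, τ.d_comm _ a]; omega)).unique hbt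
            subst this
            have := mem_half.1 ht.2
            have := τ.d_comm (y • v) a
            omega
          have hsub2 : τ.half (y • b) (y • v) ⊆ τ.half a c := by
            refine half_subset_half (a := y • v) ?_ ?_ hc
            · rw [τ.d_smul, τ.d_comm]; exact hb.1
            · rw [d_self, τ.d_comm a]; omega
          have hcv : v ≠ c := by
            rintro rfl
            omega
          have hkc : x ^ k • c ≠ c := fun hkc =>
            hk (τ.eq_one_of_fix hav hc.1 hcv hka (zpow_smul_eq hx k) hkc)
          have hm : x ^ k • u ∈ τ.half (x ^ k • a) (x ^ k • c) := mem_half_smul.2 (hsub2 h2)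
          have hd : τ.d a (x ^ k • c) = 1 := by
            rw [← hc.1, ← τ.d_smul (x ^ k) a c, hka]
          rw [hka] at hm
          exact Set.disjoint_left.1 (disjoint_half hd hc.1 hkc) hm (hsub2 h1)
        · exact Set.disjoint_left.1 (disjoint_half (d_zpow_smul hx ha.1 k) ha.1 hka)
            (hA u (hsub h2) k) (hsub h1)
  · rw [zpow_smul_eq hx]
    rintro (h1 | h1)
    · exact notMem_half_self h1
    · exact notMem_half_self (hsub h1)

theorem isPingPong_inv_right {p : V} (h : IsPingPong x y⁻¹ p) : IsPingPong x y p := by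
  obtain ⟨Y, h1, h2⟩ := h
  refine ⟨Y, h1, fun k hk u hu => ?_⟩
  have := h2 (-k)
  simp only [zpow_neg, inv_zpow, inv_inv] at this
  exact this hk u hu

theorem hasPingPong_of_fix (hmin : τ.IsMinimal H x y v) (hx : x • v = v) (hy : y • v ≠ v) :
    HasPingPong V H := by
  obtain ⟨a, ha⟩ := exists_Next (τ := τ) (Ne.symm hy)
  obtain ⟨b, hb⟩ := exists_Next (τ := τ) (inv_smul_ne hy)
  by_cases hab : ∃ k : ℤ, x ^ k • a = b
  · obtain ⟨k, hk⟩ := hab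
    have hmin' := hmin.mul_zpow hx k
    have hv : (y * x ^ k) • v = y • v := by rw [mul_smul, zpow_smul_eq hx]
    have ha' : τ.Next v ((y * x ^ k) • v) a := by rwa [hv]
    have hb' : τ.Next v ((y * x ^ k)⁻¹ • v) a := by
      have := hb.smul (x ^ (-k))
      rw [zpow_smul_eq hx, ← hk, ← mul_smul, ← mul_smul, ← zpow_add, neg_add_cancel, zpow_zero,
        one_smul] at this
      rwa [mul_inv_rev, ← zpow_neg]
    have hxa : x • a ≠ a := by
      intro hxa
      have h1 := hmin'.2 x (y * x ^ k) a hmin'.1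
      have h2 := d_smul_of_Next ha' hb'
      rw [hxa, hx, d_self, d_self] at h1
      omega
    obtain ⟨p, hp⟩ := exists_wanders_half_of_Next (by rwa [hv]) ha' hb'
    exact ⟨x, _, v, hmin'.1, _, wanders_half_of_fix ha.1 hx hxa,
      hp.isAbsorbing (by rw [compl_half]; rw [τ.d_comm]; exact ha.1)⟩
  · push Not at hab
    by_cases hfix : ∀ k : ℤ, x ^ k ≠ 1 → x ^ k • b ≠ b
    · exact ⟨x, y, v, hmin.1, isPingPong_of_fix_aux hx ha hb hab hfix⟩
    · push Not at hfix
      obtain ⟨k, hk, hkb⟩ := hfix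
      have hxb := smul_eq_of_zpow_smul_eq hb.1 hx hk hkb
      refine ⟨x, y, v, hmin.1, isPingPong_inv_right (isPingPong_of_fix_aux (a := b) (b := a) hx
        hb (by rwa [inv_inv]) ?_ ?_)⟩
      · intro j hj
        refine hab (-j) ?_
        rw [← hj, ← mul_smul, ← zpow_add, neg_add_cancel, zpow_zero, one_smul]
      · intro j hj hja
        exact hj (τ.eq_one_of_fix ha.1 hb.1 (by simpa using hab 0) (zpow_smul_eq hx j) hja
          (zpow_smul_eq hxb j))

theorem hasPingPong_of_Next_eq (hmin : τ.IsMinimal H x y v) (hx : x • v ≠ v) (hy : y • v ≠ v)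
    (ha : τ.Next v (x • v) a) (hb : τ.Next v (x⁻¹ • v) a) : HasPingPong V H := by
  have h0 := d_smul_of_Next ha hb
  have hva : τ.d (y • v) (y • a) = 1 := by rw [τ.d_smul]; exact ha.1
  have h1 := hmin.2 x y a hmin.1
  have hay1 : y • v ∉ τ.half v a := by
    intro hm
    have := mem_half.1 hm
    have := d_triangle (τ := τ) a (y • v) (y • a)
    omega
  have hay2 : y⁻¹ • v ∉ τ.half v a := by
    intro hm
    have h2 := mem_half.1 hm
    rw [d_inv_smul, ← τ.d_smul y a, smul_inv_smul] at h2
    have h3 := d_triangle (τ := τ) a v (y • a)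
    rw [τ.d_comm a v, ha.1, τ.d_comm v (y • a)] at h3
    omega
  obtain ⟨p, hp⟩ := exists_wanders_half ha.1 (fun h => absurd h hy) hay1 hay2
  obtain ⟨q, hq⟩ := exists_wanders_half_of_Next hx ha hb
  exact ⟨y, x, p, hmin.swap.1, _, hp,
    hq.isAbsorbing (by rw [compl_half]; rw [τ.d_comm]; exact ha.1)⟩

/-- The half-trees at a vertex `b` on the geodesic from `v` to `x⁻¹ • v` form Schottky data. -/
theorem exists_isSchottky {a a' : V} (ha : τ.Next v (x • v) a) (ha' : τ.Next v (x⁻¹ • v) a')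
    (hb : τ.d v b + τ.d b (x⁻¹ • v) = τ.d v (x⁻¹ • v)) (hc : τ.Next b (x⁻¹ • v) c) :
    ∃ C D : Set V, IsSchottky x C D ∧ C ⊆ τ.half b c ∧ C ⊆ τ.half v a' ∧ D ⊆ τ.half v a := by
  have h1 := mem_half.1 hc.2
  refine ⟨_, _, isSchottky_half x hc.1, subset_rfl, half_subset_half hc.1 (by omega) ha', ?_⟩
  refine half_subset_half (a := x • v) (by rw [τ.d_smul, τ.d_comm]; exact hc.1) ?_ ha
  have h2 := τ.d_smul x c (x⁻¹ • v)
  rw [smul_inv_smul] at h2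
  rw [τ.d_comm v (x • c), h2, τ.d_smul, τ.d_comm b v, ← d_inv_smul]
  omega

theorem hasPingPong_of_Next_ne {a a' b b' : V} (hmin : τ.IsMinimal H x y v)
    (ha : τ.Next v (x • v) a) (ha' : τ.Next v (x⁻¹ • v) a') (hb : τ.Next v (y • v) b)
    (hb' : τ.Next v (y⁻¹ • v) b') (h1 : a ≠ a') (h2 : b ≠ b') (h3 : a ≠ b) (h4 : a ≠ b')
    (h5 : a' ≠ b) : HasPingPong V H := by
  have hposx : 0 < τ.d v (x⁻¹ • v) := Nat.pos_of_ne_zero fun h => ha'.ne (τ.d_eq_zero.1 h)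
  have hposy : 0 < τ.d v (y⁻¹ • v) := Nat.pos_of_ne_zero fun h => hb'.ne (τ.d_eq_zero.1 h)
  obtain ⟨m, hm1, hm2, hm3⟩ := τ.exists_median v (x⁻¹ • v) (y⁻¹ • v)
  have hle1 := hmin.inv_left.inv_right.le_d
  have hle2 := hmin.inv_left.inv_right.swap.le_d
  rw [τ.d_comm (y⁻¹ • v)] at hle2
  have e1 := τ.d_comm (x⁻¹ • v) m
  obtain ⟨c, hc⟩ := exists_Next (τ := τ) (v := m) (u := x⁻¹ • v) (by
    rintro h
    have : τ.d m (x⁻¹ • v) = 0 := τ.d_eq_zero.2 h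
    omega)
  obtain ⟨c', hc'⟩ := exists_Next (τ := τ) (v := m) (u := y⁻¹ • v) (by
    rintro h
    have : τ.d m (y⁻¹ • v) = 0 := τ.d_eq_zero.2 h
    omega)
  have hcc' : c ≠ c' := Next_ne_of_between hc hc' hm3
  obtain ⟨C, D, hS, s1, s2, s3⟩ := exists_isSchottky ha ha' hm1 hc
  obtain ⟨C', D', hS', s1', s2', s3'⟩ := exists_isSchottky hb hb' hm2 hc'
  have dis : ∀ {w w' : V} {S S' : Set V}, τ.d v w = 1 → τ.d v w' = 1 → w ≠ w' → S ⊆ τ.half v w →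
      S' ⊆ τ.half v w' → Disjoint S S' := fun h h' hne hS hS' =>
    (disjoint_half h h' hne).mono hS hS'
  refine ⟨x, y, v, hmin.1, _, hS.wanders (dis ha'.1 ha.1 h1.symm s2 s3)
    (Set.disjoint_union_left.2 ⟨(disjoint_half hc'.1 hc.1 hcc'.symm).mono s1' s1,
      dis hb.1 ha'.1 h5.symm s3' s2⟩)
    (Set.disjoint_union_left.2 ⟨dis hb'.1 ha.1 h4.symm s2' s3, dis hb.1 ha.1 h3.symm s3' s3⟩)
    ?_ (fun h => notMem_half_self (s2 h)) (fun h => notMem_half_self (s3 h)),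
    hS'.isAbsorbing (dis hb'.1 hb.1 h2.symm s2' s3')⟩
  rintro (h | h)
  · exact notMem_half_self (s2' h)
  · exact notMem_half_self (s3' h)

/-- Moving `v` to a point `c` between `v` and `x • v` does not increase the displacement. -/
theorem d_smul_le_of_between (h : τ.d v c + τ.d c (x • v) = τ.d v (x • v)) :
    τ.d c (x • c) ≤ τ.d v (x • v) := by
  have := d_triangle (τ := τ) c (x • v) (x • c)
  rw [τ.d_smul] at this
  omega

theorem hasPingPong_of_Next_common {a : V} (hmin : τ.IsMinimal H x y v)
    (hx : τ.Next v (x • v) a) (hy : τ.Next v (y • v) a) : HasPingPong V H := by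
  have hposx : 0 < τ.d v (x • v) := Nat.pos_of_ne_zero fun h => hx.ne (τ.d_eq_zero.1 h)
  have hposy : 0 < τ.d v (y • v) := Nat.pos_of_ne_zero fun h => hy.ne (τ.d_eq_zero.1 h)
  obtain ⟨c, hc1, hc2, hc3⟩ := τ.exists_median v (x • v) (y • v)
  have hle1 := hmin.le_d
  have hle2 := hmin.swap.le_d
  rw [τ.d_comm (y • v)] at hle2
  have e1 := τ.d_comm (x • v) c
  have hcx : c ≠ x • v := by
    rintro h
    have : τ.d c (x • v) = 0 := τ.d_eq_zero.2 h
    omega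
  have hcy : c ≠ y • v := by
    rintro h
    have : τ.d c (y • v) = 0 := τ.d_eq_zero.2 h
    omega
  have hlx := d_smul_le_of_between hc1
  have hly := d_smul_le_of_between hc2
  have hmin' : τ.IsMinimal H x y c := hmin.of_le (by omega)
  have hle := hmin.2 x y c hmin.1
  obtain ⟨s, hs⟩ := exists_Next (τ := τ) hcx
  obtain ⟨t, ht⟩ := exists_Next (τ := τ) hcy
  have hst : s ≠ t := Next_ne_of_between hs ht hc3
  have hvc : c ≠ v := by
    rintro rfl
    exact hst (hs.unique hx |>.trans (ht.unique hy).symm)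
  have hs' : τ.Next c (x • c) s := hs.of_between (by rw [τ.d_smul]; omega)
  have ht' : τ.Next c (y • c) t := ht.of_between (by rw [τ.d_smul]; omega)
  obtain ⟨m, hm⟩ := exists_Next (τ := τ) hvc
  have back : ∀ z : G, τ.d v c + τ.d c (z • v) = τ.d v (z • v) →
      τ.d c (z • c) = τ.d v (z • v) → τ.Next c (z⁻¹ • c) m := by
    intro z h1 h2
    refine hm.of_between ?_
    have e2 : τ.d v (z⁻¹ • c) = τ.d c (z • v) := by
      rw [← τ.d_smul z v, smul_inv_smul, τ.d_comm]
    have e3 : τ.d c (z⁻¹ • c) = τ.d c (z • c) := d_inv_smul ..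
    have e4 := τ.d_comm c v
    have e5 := τ.d_comm (z • v) c
    omega
  have hxm := back x hc1 (by omega)
  have hym := back y hc2 (by omega)
  by_cases h1 : s = m
  · exact hasPingPong_of_Next_eq hmin' hs'.ne.symm ht'.ne.symm hs' (h1 ▸ hxm)
  by_cases h2 : t = m
  · exact hasPingPong_of_Next_eq hmin'.swap ht'.ne.symm hs'.ne.symm ht' (h2 ▸ hym)
  exact hasPingPong_of_Next_ne hmin' hs' hxm ht' hym h1 h2 hst h1 (Ne.symm h2)

/-- A two-generator group acting on a tree so that nontrivial elements fix at most one edge fixes a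
vertex or has a generating pair in ping-pong position. -/
theorem exists_fixed_or_hasPingPong [Nonempty V] (τ : TreeAction G V) (x y : G) :
    (∃ v : V, ∀ g ∈ Subgroup.closure {x, y}, g • v = v) ∨
      HasPingPong V (Subgroup.closure {x, y}) := by
  obtain ⟨x', y', v, hmin⟩ := exists_isMinimal τ (Classical.arbitrary V) x y
  by_cases hx : x' • v = v
  · by_cases hy : y' • v = v
    · left
      refine ⟨v, fun g hg => ?_⟩
      rw [← hmin.1] at hg
      have : Subgroup.closure {x', y'} ≤ MulAction.stabilizer G v := by
        rw [Subgroup.closure_le]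
        rintro z (rfl | rfl)
        · exact hx
        · exact hy
      exact this hg
    · exact Or.inr (hasPingPong_of_fix hmin hx hy)
  right
  by_cases hy : y' • v = v
  · exact hasPingPong_of_fix hmin.swap hy hx
  obtain ⟨a, ha⟩ := exists_Next (τ := τ) (Ne.symm hx)
  obtain ⟨a', ha'⟩ := exists_Next (τ := τ) (inv_smul_ne hx)
  obtain ⟨b, hb⟩ := exists_Next (τ := τ) (Ne.symm hy)
  obtain ⟨b', hb'⟩ := exists_Next (τ := τ) (inv_smul_ne hy)
  by_cases h1 : a = a'
  · exact hasPingPong_of_Next_eq hmin hx hy ha (h1 ▸ ha')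
  by_cases h2 : b = b'
  · exact hasPingPong_of_Next_eq hmin.swap hy hx hb (h2 ▸ hb')
  by_cases h3 : a = b
  · exact hasPingPong_of_Next_common hmin ha (h3 ▸ hb)
  by_cases h4 : a = b'
  · exact hasPingPong_of_Next_common hmin.inv_right ha (h4 ▸ hb')
  by_cases h5 : a' = b
  · exact hasPingPong_of_Next_common hmin.inv_left ha' (h5 ▸ hb)
  exact hasPingPong_of_Next_ne hmin ha ha' hb hb' h1 h2 h3 h4 h5

end TreeAction

section PresentedCyclics

/-- The relators `a_i ^ e_i`. -/
def cyclicRels {ι : Type*} (e : ι → ℕ) : Set (FreeGroup ι) := {w | ∃ i, w = FreeGroup.of i ^ e i}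

variable {ι G : Type*} [Group G] {e : ι → ℕ}

theorem presentedGroup_of_pow (e : ι → ℕ) (i : ι) :
    (PresentedGroup.of i : PresentedGroup (cyclicRels e)) ^ e i = 1 :=
  PresentedGroup.one_of_mem (rels := cyclicRels e) ⟨i, rfl⟩

theorem presentedGroup_of_zpow_eq_one (e : ι → ℕ) (i : ι) {k : ℤ} (h : (e i : ℤ) ∣ k) :
    (PresentedGroup.of i : PresentedGroup (cyclicRels e)) ^ k = 1 := by
  obtain ⟨l, rfl⟩ := h
  rw [zpow_mul, zpow_natCast, presentedGroup_of_pow, one_zpow]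

/-- The homomorphism from a free product of cyclic groups given by images of the generators. -/
def cyclicLift (f : ι → G) (h : ∀ i, f i ^ e i = 1) : PresentedGroup (cyclicRels e) →* G :=
  PresentedGroup.toGroup (f := f) (by rintro _ ⟨i, rfl⟩; simp [h])

@[simp]
theorem cyclicLift_of (f : ι → G) (h : ∀ i, f i ^ e i = 1) (i : ι) :
    cyclicLift f h (PresentedGroup.of i) = f i :=
  PresentedGroup.toGroup.of _

end PresentedCyclics

section PairPresentation

variable {G V : Type*} [Group G] [MulAction G V] {x y : G} {p : V}

/-- The exponents of the free product of the cyclic groups generated by `x` and `y`. -/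
noncomputable def pairOrders (x y : G) (i : Bool) : ℕ := cond i (orderOf x) (orderOf y)

/-- The natural homomorphism from the free product of the cyclic groups generated by `x` and
`y`. -/
noncomputable def pairHom (x y : G) : PresentedGroup (cyclicRels (pairOrders x y)) →* G :=
  cyclicLift (fun i => cond i x y) (by rintro (_ | _) <;> exact pow_orderOf_eq_one _)

theorem pairHom_true (k : ℤ) : pairHom x y (PresentedGroup.of true ^ k) = x ^ k := by
  simp [pairHom]

theorem pairHom_false (k : ℤ) : pairHom x y (PresentedGroup.of false ^ k) = y ^ k := by
  simp [pairHom]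

theorem pairHom_range : (pairHom x y).range = Subgroup.closure {x, y} := by
  rw [MonoidHom.range_eq_map, ← PresentedGroup.closure_range_of, MonoidHom.map_closure]
  congr 1
  ext z
  simp [pairHom, eq_comm, or_comm]

theorem of_true_zpow_eq_one {k : ℤ} (h : x ^ k = 1) :
    (PresentedGroup.of true : PresentedGroup (cyclicRels (pairOrders x y))) ^ k = 1 :=
  presentedGroup_of_zpow_eq_one _ _ (orderOf_dvd_iff_zpow_eq_one.2 h)

theorem of_false_zpow_eq_one {k : ℤ} (h : y ^ k = 1) :
    (PresentedGroup.of false : PresentedGroup (cyclicRels (pairOrders x y))) ^ k = 1 :=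
  presentedGroup_of_zpow_eq_one _ _ (orderOf_dvd_iff_zpow_eq_one.2 h)

/-- Elements represented by an alternating word whose first syllable comes from `y`. -/
inductive StartsWithSnd (x y : G) : PresentedGroup (cyclicRels (pairOrders x y)) → Prop
  | base (j k : ℤ) (hj : y ^ j ≠ 1) :
      StartsWithSnd x y (PresentedGroup.of false ^ j * PresentedGroup.of true ^ k)
  | step (j k : ℤ) {g : PresentedGroup (cyclicRels (pairOrders x y))} (hj : y ^ j ≠ 1)
      (hk : x ^ k ≠ 1) (hg : StartsWithSnd x y g) :
      StartsWithSnd x y (PresentedGroup.of false ^ j * (PresentedGroup.of true ^ k * g))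

/-- Elements represented by an alternating word. -/
def IsAlternating (g : PresentedGroup (cyclicRels (pairOrders x y))) : Prop :=
  ∃ k : ℤ, g = PresentedGroup.of true ^ k ∨
    ∃ g', StartsWithSnd x y g' ∧ g = PresentedGroup.of true ^ k * g'

theorem StartsWithSnd.isAlternating {g : PresentedGroup (cyclicRels (pairOrders x y))}
    (h : StartsWithSnd x y g) : IsAlternating g :=
  ⟨0, Or.inr ⟨g, h, by simp⟩⟩

theorem IsAlternating.true_mul {g : PresentedGroup (cyclicRels (pairOrders x y))}
    (h : IsAlternating g) (m : ℤ) : IsAlternating (PresentedGroup.of true ^ m * g) := by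
  obtain ⟨k, rfl | ⟨g', hg', rfl⟩⟩ := h
  · exact ⟨m + k, Or.inl (zpow_add ..).symm⟩
  · exact ⟨m + k, Or.inr ⟨g', hg', by rw [zpow_add, mul_assoc]⟩⟩

theorem StartsWithSnd.false_mul {g : PresentedGroup (cyclicRels (pairOrders x y))}
    (h : StartsWithSnd x y g) (m : ℤ) : IsAlternating (PresentedGroup.of false ^ m * g) := by
  cases h with
  | base j k hj =>
    rw [← mul_assoc, ← zpow_add]
    by_cases hm : y ^ (m + j) = 1
    · rw [of_false_zpow_eq_one hm, one_mul]
      exact ⟨k, Or.inl rfl⟩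
    · exact (StartsWithSnd.base _ _ hm).isAlternating
  | step j k hj hk hg =>
    rw [← mul_assoc, ← zpow_add]
    by_cases hm : y ^ (m + j) = 1
    · rw [of_false_zpow_eq_one hm, one_mul]
      exact ⟨k, Or.inr ⟨_, hg, rfl⟩⟩
    · exact (StartsWithSnd.step _ _ hm hk hg).isAlternating

theorem IsAlternating.false_mul {g : PresentedGroup (cyclicRels (pairOrders x y))}
    (h : IsAlternating g) (m : ℤ) : IsAlternating (PresentedGroup.of false ^ m * g) := by
  by_cases hm : y ^ m = 1
  · rwa [of_false_zpow_eq_one hm, one_mul]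
  obtain ⟨k, rfl | ⟨g', hg', rfl⟩⟩ := h
  · exact (StartsWithSnd.base _ _ hm).isAlternating
  · by_cases hk : x ^ k = 1
    · rw [of_true_zpow_eq_one hk, one_mul]
      exact hg'.false_mul m
    · exact (StartsWithSnd.step _ _ hm hk hg').isAlternating

theorem isAlternating (g : PresentedGroup (cyclicRels (pairOrders x y))) : IsAlternating g := by
  have hg : g ∈ Subgroup.closure (Set.range PresentedGroup.of) := by
    rw [PresentedGroup.closure_range_of]; trivial
  have key : ∀ (i : Bool) (m : ℤ) {g : PresentedGroup (cyclicRels (pairOrders x y))},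
      IsAlternating g → IsAlternating (PresentedGroup.of i ^ m * g) := by
    rintro (_ | _) m g h
    · exact h.false_mul m
    · exact h.true_mul m
  induction hg using Subgroup.closure_induction_left with
  | one => exact ⟨0, Or.inl (by simp)⟩
  | mul_left x hx y hy ih =>
    obtain ⟨i, rfl⟩ := hx
    simpa using key i 1 ih
  | inv_mul_cancel x hx y hy ih =>
    obtain ⟨i, rfl⟩ := hx
    simpa using key i (-1) ih

theorem StartsWithSnd.smul_mem {g : PresentedGroup (cyclicRels (pairOrders x y))} {Y : Set V}
    (h : StartsWithSnd x y g) (hx : Wanders x Y p) (hy : IsAbsorbing y Y) :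
    pairHom x y g • p ∈ Y := by
  induction h with
  | base j k hj =>
    rw [map_mul, pairHom_true, pairHom_false, mul_smul]
    exact hy j hj _ (hx.2 k)
  | step j k hj hk _ ih =>
    rw [map_mul, map_mul, pairHom_true, pairHom_false, mul_smul, mul_smul]
    exact hy j hj _ (hx.1 k hk _ ih)

theorem IsPingPong.eq_zpow_of_fix (h : IsPingPong x y p)
    {g : PresentedGroup (cyclicRels (pairOrders x y))} (hg : pairHom x y g • p = p) :
    ∃ k : ℤ, g = PresentedGroup.of true ^ k := by
  obtain ⟨Y, hx, hy⟩ := h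
  obtain ⟨k, hk | ⟨g', hg', rfl⟩⟩ := isAlternating g
  · exact ⟨k, hk⟩
  · exfalso
    rw [map_mul, pairHom_true, mul_smul] at hg
    have h1 : pairHom x y g' • p = x ^ (-k) • p := by
      rw [zpow_neg, eq_inv_smul_iff, hg]
    exact hx.2 (-k) (h1 ▸ hg'.smul_mem hx hy)

theorem IsPingPong.pairHom_injective (h : IsPingPong x y p) :
    Function.Injective (pairHom x y) := by
  rw [injective_iff_map_eq_one]
  intro g hg
  obtain ⟨k, rfl⟩ := h.eq_zpow_of_fix (g := g) (by rw [hg, one_smul])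
  rw [pairHom_true] at hg
  exact of_true_zpow_eq_one hg

theorem IsPingPong.isFreeProductOfCyclics (h : IsPingPong x y p) :
    IsFreeProductOfCyclics (Subgroup.closure {x, y}) :=
  ⟨Bool, pairOrders x y, ⟨((MonoidHom.ofInjective h.pairHom_injective).trans
    (MulEquiv.subgroupCongr pairHom_range)).symm⟩⟩

theorem IsPingPong.mem_zpowers (h : IsPingPong x y p) {g : G} (hg : g ∈ Subgroup.closure {x, y})
    (hp : g • p = p) : g ∈ Subgroup.zpowers x := by
  rw [← pairHom_range] at hg
  obtain ⟨g, rfl⟩ := hg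
  obtain ⟨k, rfl⟩ := h.eq_zpow_of_fix hp
  exact ⟨k, (pairHom_true k).symm⟩

theorem HasPingPong.isFreeProductOfCyclics {H : Subgroup G} (h : HasPingPong V H) :
    IsFreeProductOfCyclics H := by
  obtain ⟨x, y, p, rfl, h⟩ := h
  exact h.isFreeProductOfCyclics

end PairPresentation

section TwoGenerator

variable {G G' : Type*} [Group G] [Group G']

/-- All two-generator subgroups are free products of cyclic groups. -/
def TwoGenFree (G : Type*) [Group G] : Prop :=
  ∀ x y : G, IsFreeProductOfCyclics (Subgroup.closure {x, y})

theorem IsFreeProductOfCyclics.of_mulEquiv (h : IsFreeProductOfCyclics G) (f : G' ≃* G) :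
    IsFreeProductOfCyclics G' := by
  obtain ⟨ι, e, ⟨f'⟩⟩ := h
  exact ⟨ι, e, ⟨f.trans f'⟩⟩

theorem isFreeProductOfCyclics_map_iff {H : Subgroup G} {f : G →* G'}
    (hf : Function.Injective f) :
    IsFreeProductOfCyclics (H.map f) ↔ IsFreeProductOfCyclics H :=
  ⟨fun h => h.of_mulEquiv (H.equivMapOfInjective f hf),
    fun h => h.of_mulEquiv (H.equivMapOfInjective f hf).symm⟩

theorem closure_pair_map (f : G →* G') (x y : G) :
    (Subgroup.closure {x, y}).map f = Subgroup.closure {f x, f y} := by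
  rw [MonoidHom.map_closure, Set.image_pair]

theorem TwoGenFree.of_injective (h : TwoGenFree G') {f : G →* G'} (hf : Function.Injective f) :
    TwoGenFree G := fun x y => by
  rw [← isFreeProductOfCyclics_map_iff hf, closure_pair_map]
  exact h _ _

theorem TwoGenFree.isFreeProductOfCyclics (h : TwoGenFree G) {f : G →* G'}
    (hf : Function.Injective f) {x y : G'} (hx : x ∈ f.range) (hy : y ∈ f.range) :
    IsFreeProductOfCyclics (Subgroup.closure {x, y}) := by
  obtain ⟨x, rfl⟩ := hx
  obtain ⟨y, rfl⟩ := hy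
  rw [← closure_pair_map, isFreeProductOfCyclics_map_iff hf]
  exact h x y

theorem isFreeProductOfCyclics_of_isCyclic [IsCyclic G] : IsFreeProductOfCyclics G := by
  obtain ⟨g, hg⟩ := IsCyclic.exists_generator (α := G)
  let f : PresentedGroup (cyclicRels fun _ : Unit => orderOf g) →* G :=
    cyclicLift (fun _ => g) fun _ => pow_orderOf_eq_one g
  have hf : Function.Bijective f := by
    constructor
    · rw [injective_iff_map_eq_one]
      intro z hz
      have hz' : z ∈ Subgroup.zpowers (PresentedGroup.of ()) := by
        have : z ∈ Subgroup.closure (Set.range PresentedGroup.of) := by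
          rw [PresentedGroup.closure_range_of]; trivial
        rwa [Set.range_unique, ← Subgroup.zpowers_eq_closure] at this
      obtain ⟨k, rfl⟩ := hz'
      have : g ^ k = 1 := by simpa [f] using hz
      exact presentedGroup_of_zpow_eq_one _ _ (orderOf_dvd_iff_zpow_eq_one.2 this)
    · intro z
      obtain ⟨k, rfl⟩ := hg z
      exact ⟨PresentedGroup.of () ^ k, by simp [f]⟩
  exact ⟨Unit, _, ⟨(MulEquiv.ofBijective f hf).symm⟩⟩

theorem twoGenFree_of_isCyclic [IsCyclic G] : TwoGenFree G :=
  fun _ _ => isFreeProductOfCyclics_of_isCyclic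

end TwoGenerator

section TreeOfGraph

variable {G V : Type*} [Group G] [MulAction G V]

theorem exists_adj_dist_add_one {Γ : SimpleGraph V} (hΓ : Γ.Connected) {v u : V} (h : v ≠ u) :
    ∃ w, Γ.Adj v w ∧ Γ.dist w u + 1 = Γ.dist v u := by
  obtain ⟨p, hp⟩ := hΓ.exists_walk_length_eq_dist v u
  cases p with
  | nil => exact absurd rfl h
  | @cons _ w _ hadj q =>
    refine ⟨w, hadj, ?_⟩
    have h1 := SimpleGraph.dist_le q
    have h2 := hΓ.dist_triangle (u := v) (v := w) (w := u)
    rw [SimpleGraph.dist_eq_one_iff_adj.2 hadj] at h2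
    rw [SimpleGraph.Walk.length_cons] at hp
    omega

theorem eq_of_adj_of_dist_add_one {Γ : SimpleGraph V} (hΓ : Γ.IsTree) {v u w w' : V}
    (hw : Γ.Adj v w) (hw' : Γ.Adj v w') (h : Γ.dist w u + 1 = Γ.dist v u)
    (h' : Γ.dist w' u + 1 = Γ.dist v u) : w = w' := by
  obtain ⟨p, hp⟩ := hΓ.connected.exists_walk_length_eq_dist w u
  obtain ⟨p', hp'⟩ := hΓ.connected.exists_walk_length_eq_dist w' u
  have h1 : (SimpleGraph.Walk.cons hw p).IsPath :=
    SimpleGraph.Walk.isPath_of_length_eq_dist _ (by rw [SimpleGraph.Walk.length_cons, hp, h])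
  have h2 : (SimpleGraph.Walk.cons hw' p').IsPath :=
    SimpleGraph.Walk.isPath_of_length_eq_dist _ (by rw [SimpleGraph.Walk.length_cons, hp', h'])
  have h3 := congrArg Subtype.val ((hΓ.isAcyclic.subsingleton_path v u).elim ⟨_, h1⟩ ⟨_, h2⟩)
  simp only [SimpleGraph.Walk.cons.injEq] at h3
  exact h3.1

/-- Distances in a connected graph are preserved by an action by graph automorphisms. -/
theorem dist_smul_of_adj_smul {Γ : SimpleGraph V} (hΓ : Γ.Connected)
    (h : ∀ (g : G) u v, Γ.Adj u v → Γ.Adj (g • u) (g • v)) (g : G) (u v : V) :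
    Γ.dist (g • u) (g • v) = Γ.dist u v := by
  have key : ∀ (g : G) (u v : V), Γ.dist (g • u) (g • v) ≤ Γ.dist u v := by
    intro g u v
    obtain ⟨p, hp⟩ := hΓ.exists_walk_length_eq_dist u v
    rw [← hp, ← SimpleGraph.Walk.length_map (⟨fun w => g • w, h g _ _⟩ : Γ →g Γ) p]
    exact SimpleGraph.dist_le _
  refine (key g u v).antisymm ?_
  simpa using key g⁻¹ (g • u) (g • v)

/-- The tree action given by an action without inversions on a tree such that nontrivial elements
fix at most one edge at any vertex. -/
noncomputable def treeActionOfIsTree {Γ : SimpleGraph V} (hΓ : Γ.IsTree)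
    (h : ∀ (g : G) u v, Γ.Adj u v → Γ.Adj (g • u) (g • v))
    (hinv : ∀ (g : G) v, ¬ Γ.Adj v (g • v))
    (hfix : ∀ {g : G} {v w w'}, Γ.Adj v w → Γ.Adj v w' → w ≠ w' → g • v = v → g • w = w →
      g • w' = w' → g = 1) : TreeAction G V where
  d := Γ.dist
  d_eq_zero := hΓ.connected.dist_eq_zero_iff
  d_comm _ _ := SimpleGraph.dist_comm
  step {v w} u hvw := by
    have := hΓ.dist_eq_dist_add_one_of_adj u (SimpleGraph.dist_eq_one_iff_adj.1 hvw)
    rw [SimpleGraph.dist_comm (u := u), SimpleGraph.dist_comm (u := u)] at this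
    omega
  exists_next hvu := by
    simpa only [SimpleGraph.dist_eq_one_iff_adj] using exists_adj_dist_add_one hΓ.connected hvu
  next_unique h1 h2 := eq_of_adj_of_dist_add_one hΓ (SimpleGraph.dist_eq_one_iff_adj.1 h1)
    (SimpleGraph.dist_eq_one_iff_adj.1 h2)
  d_smul := dist_smul_of_adj_smul hΓ.connected h
  d_smul_ne_one g v := by
    rw [Ne, SimpleGraph.dist_eq_one_iff_adj]
    exact hinv g v
  eq_one_of_fix h1 h2 := hfix (SimpleGraph.dist_eq_one_iff_adj.1 h1)
    (SimpleGraph.dist_eq_one_iff_adj.1 h2)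

/-- A graph is acyclic if every edge is the only edge between some set and its complement. -/
theorem isAcyclic_of_forall_separating {Γ : SimpleGraph V}
    (h : ∀ u v, Γ.Adj u v → ∃ F : Set V, ¬ (u ∈ F ↔ v ∈ F) ∧
      ∀ a b, Γ.Adj a b → ¬ (a ∈ F ↔ b ∈ F) → s(a, b) = s(u, v)) : Γ.IsAcyclic := by
  rw [SimpleGraph.isAcyclic_iff_forall_adj_isBridge]
  intro u v huv
  obtain ⟨F, h1, h2⟩ := h u v huv
  rw [SimpleGraph.isBridge_iff]
  rintro ⟨p⟩
  refine h1 ?_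
  clear h1
  suffices ∀ {a b : V} (_ : (Γ.deleteEdges {s(u, v)}).Walk a b), (a ∈ F ↔ b ∈ F) from this p
  intro a b p
  induction p with
  | nil => rfl
  | @cons a b c hab _ ih =>
    rw [← ih]
    by_contra hF
    rw [SimpleGraph.deleteEdges_adj] at hab
    exact hab.2 (h2 a b hab.1 hF)

end TreeOfGraph

/-- A splitting of a group as an amalgamated product of `K true` and `K false` over `A`, expressed
by the sets `S b` of elements whose normal forms start with a syllable from `K b`. -/
structure IsBipolar {G : Type*} [Group G] (K : Bool → Subgroup G) (A : Subgroup G)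
    (S : Bool → Set G) : Prop where
  le : ∀ b, A ≤ K b
  gen : ⨆ b, K b = ⊤
  disjoint : ∀ {g} b, g ∈ S b → g ∉ S (!b)
  notMem : ∀ {g} b, g ∈ S b → g ∉ A
  mul_mem_same : ∀ {g k} b, g ∈ S b → k ∈ K b → g * k ∈ S b ∨ g * k ∈ A
  mul_mem_not : ∀ {g k} b, g ∈ S b → k ∈ K (!b) → g * k ∈ S b
  mem_of_mem : ∀ {k} b, k ∈ K b → k ∉ A → k ∈ S b

section BassSerre

variable {G : Type*} [Group G] {K : Bool → Subgroup G} {A : Subgroup G} {S : Bool → Set G}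

/-- The coset `g K_b` as a vertex of the Bass-Serre tree. -/
def vert (K : Bool → Subgroup G) (b : Bool) (g : G) : Σ b, G ⧸ K b := ⟨b, g⟩

theorem vert_eq_iff {b b' : Bool} {g g' : G} :
    vert K b g = vert K b' g' ↔ b = b' ∧ g⁻¹ * g' ∈ K b := by
  constructor
  · intro h
    obtain rfl : b = b' := congrArg Sigma.fst h
    exact ⟨rfl, QuotientGroup.eq.1 (eq_of_heq (Sigma.mk.inj h).2)⟩
  · rintro ⟨rfl, h⟩
    exact congrArg (Sigma.mk b) (QuotientGroup.eq.2 h)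

theorem smul_vert (b : Bool) (g g' : G) : g • vert K b g' = vert K b (g * g') := rfl

theorem exists_eq_vert (v : Σ b, G ⧸ K b) : ∃ b g, v = vert K b g := by
  obtain ⟨b, g⟩ := v
  obtain ⟨g, rfl⟩ := QuotientGroup.mk_surjective g
  exact ⟨b, g, rfl⟩

/-- The Bass-Serre tree: `g K_true` is adjacent to `g K_false`. -/
def bassSerre (K : Bool → Subgroup G) : SimpleGraph (Σ b, G ⧸ K b) where
  Adj u v := ∃ b g, u = vert K b g ∧ v = vert K (!b) g
  symm := ⟨by
    rintro _ _ ⟨b, g, rfl, rfl⟩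
    exact ⟨!b, g, rfl, by rw [Bool.not_not]⟩⟩
  loopless := ⟨by
    rintro _ ⟨b, g, rfl, h⟩
    simpa using (vert_eq_iff.1 h).1⟩

/-- The vertices on the side of `K_false` after removal of the edge from `K_true` to `K_false`. -/
def falseSide (K : Bool → Subgroup G) (S : Bool → Set G) : Set (Σ b, G ⧸ K b) :=
  {v | (∃ g ∈ S false, v = vert K true g) ∨ v.1 = false ∧ ∀ g ∈ S true, v ≠ vert K false g}

namespace IsBipolar

variable (h : IsBipolar K A S)

include h

theorem induction_right {P : G → Prop} (h1 : P 1) (hmul : ∀ g b, P g → ∀ k ∈ K b, P (g * k))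
    (g : G) : P g := by
  have hg : g ∈ Subgroup.closure (⋃ b, (K b : Set G)) := by
    rw [← Subgroup.iSup_eq_closure, h.gen]
    trivial
  induction hg using Subgroup.closure_induction_right with
  | one => exact h1
  | mul_right x hx y hy ih =>
    obtain ⟨b, hb⟩ := Set.mem_iUnion.1 hy
    exact hmul _ b ih _ hb
  | mul_inv_cancel x hx y hy ih =>
    obtain ⟨b, hb⟩ := Set.mem_iUnion.1 hy
    exact hmul _ b ih _ (inv_mem hb)

theorem mem_or_exists_mem (g : G) : g ∈ A ∨ ∃ b, g ∈ S b := by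
  induction g using h.induction_right with
  | h1 => exact Or.inl (one_mem _)
  | hmul g b ih k hk =>
    rcases ih with ih | ⟨b', ih⟩
    · by_cases hA : g * k ∈ A
      · exact Or.inl hA
      · exact Or.inr ⟨b, h.mem_of_mem b (mul_mem (h.le b ih) hk) hA⟩
    · by_cases hb : b = b'
      · subst hb
        exact (h.mul_mem_same b ih hk).elim (fun h => Or.inr ⟨b, h⟩) Or.inl
      · obtain rfl : b = !b' := by cases b <;> cases b' <;> simp_all
        exact Or.inr ⟨b', h.mul_mem_not b' ih hk⟩

theorem mem_of_mem_of_mem {b : Bool} {k : G} (h1 : k ∈ K b) (h2 : k ∈ K (!b)) : k ∈ A := by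
  by_contra hA
  exact h.disjoint b (h.mem_of_mem b h1 hA) (h.mem_of_mem (!b) h2 hA)

theorem connected : (bassSerre K).Connected := by
  have key : ∀ g b, (bassSerre K).Reachable (vert K true 1) (vert K b g) := by
    have adj : ∀ b g, (bassSerre K).Adj (vert K b g) (vert K (!b) g) := fun b g => ⟨b, g, rfl, rfl⟩
    have both : ∀ b g, (bassSerre K).Reachable (vert K true 1) (vert K b g) →
        ∀ b', (bassSerre K).Reachable (vert K true 1) (vert K b' g) := by
      intro b g hr b'
      by_cases hb : b = b'
      · exact hb ▸ hr
      · obtain rfl : b' = !b := by cases b <;> cases b' <;> simp_all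
        exact hr.trans (adj b g).reachable
    intro g
    induction g using h.induction_right with
    | h1 => exact both true 1 (SimpleGraph.Reachable.refl _)
    | hmul g b ih k hk =>
      refine both b _ ?_
      have : vert K b (g * k) = vert K b g :=
        (vert_eq_iff.2 ⟨rfl, by rwa [inv_mul_cancel_left]⟩).symm
      rw [this]
      exact ih b
  have : Nonempty (Σ b, G ⧸ K b) := ⟨vert K true 1⟩
  refine ⟨fun u v => ?_⟩
  obtain ⟨b, g, rfl⟩ := exists_eq_vert u
  obtain ⟨b', g', rfl⟩ := exists_eq_vert v
  exact (key g b).symm.trans (key g' b')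

theorem mul_notMem {b : Bool} {g k : G} (hg : g ∈ S b ∨ g ∈ A) (hk : k ∈ K b) :
    g * k ∉ S (!b) := by
  intro hS
  have hA : g * k ∉ A := h.notMem _ hS
  rcases hg with hg | hg
  · rcases h.mul_mem_same b hg hk with h' | h'
    · exact h.disjoint b h' hS
    · exact hA h'
  · exact h.disjoint b (h.mem_of_mem b (mul_mem (h.le b hg) hk) hA) hS

theorem mem_falseSide_true {g : G} : vert K true g ∈ falseSide K S ↔ g ∈ S false := by
  constructor
  · rintro (⟨g', hg', hv⟩ | ⟨hv, -⟩)
    · by_contra hg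
      obtain ⟨-, hk⟩ := vert_eq_iff.1 hv
      refine h.mul_notMem (b := true) (g := g) ?_ hk (by rwa [mul_inv_cancel_left])
      rcases h.mem_or_exists_mem g with hA | ⟨_ | _, hb⟩
      · exact Or.inr hA
      · exact absurd hb hg
      · exact Or.inl hb
    · cases hv
  · exact fun hg => Or.inl ⟨g, hg, rfl⟩

theorem mem_falseSide_false {g : G} : vert K false g ∈ falseSide K S ↔ g ∉ S true := by
  constructor
  · rintro (⟨g', hg', hv⟩ | ⟨-, hv⟩) hg
    · cases (vert_eq_iff.1 hv).1
    · exact hv g hg rfl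
  · refine fun hg => Or.inr ⟨rfl, fun g' hg' hv => ?_⟩
    obtain ⟨-, hk⟩ := vert_eq_iff.1 hv
    refine h.mul_notMem (b := false) (g := g) ?_ hk (by rwa [mul_inv_cancel_left])
    rcases h.mem_or_exists_mem g with hA | ⟨_ | _, hb⟩
    · exact Or.inr hA
    · exact Or.inl hb
    · exact absurd hb hg

theorem mem_falseSide_iff (b : Bool) (g : G) :
    (vert K b g ∈ falseSide K S ↔ vert K (!b) g ∈ falseSide K S) ↔ g ∉ A := by
  have key : (g ∈ S false ↔ g ∉ S true) ↔ g ∉ A := by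
    rcases h.mem_or_exists_mem g with hA | ⟨_ | _, hb⟩
    · have h1 : g ∉ S true := fun hb => h.notMem _ hb hA
      have h2 : g ∉ S false := fun hb => h.notMem _ hb hA
      tauto
    · have h1 := h.disjoint _ hb
      have h2 := h.notMem _ hb
      simp only [Bool.not_false] at h1
      tauto
    · have h1 := h.disjoint _ hb
      have h2 := h.notMem _ hb
      simp only [Bool.not_true] at h1
      tauto
  cases b
  · rw [Bool.not_false, h.mem_falseSide_true, h.mem_falseSide_false, ← key]
    tauto
  · rw [Bool.not_true, h.mem_falseSide_true, h.mem_falseSide_false, ← key]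

theorem isAcyclic : (bassSerre K).IsAcyclic := by
  refine isAcyclic_of_forall_separating ?_
  rintro _ _ ⟨b, g, rfl, rfl⟩
  refine ⟨{w | g⁻¹ • w ∈ falseSide K S}, ?_, ?_⟩
  · simp only [Set.mem_ofPred_eq, smul_vert]
    rw [h.mem_falseSide_iff, inv_mul_cancel, not_not]
    exact one_mem _
  · rintro _ _ ⟨b', g', rfl, rfl⟩ h1
    simp only [Set.mem_ofPred_eq, smul_vert] at h1
    rw [h.mem_falseSide_iff, not_not] at h1
    have h2 : ∀ b, vert K b g = vert K b g' := fun b => vert_eq_iff.2 ⟨rfl, h.le b h1⟩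
    rw [← h2, ← h2]
    by_cases hb : b' = b
    · rw [hb]
    · obtain rfl : b' = !b := by cases b <;> cases b' <;> simp_all
      rw [Bool.not_not, Sym2.eq_swap]

/-- The action on the Bass-Serre tree. -/
noncomputable def treeAction (hA : IsMalnormal A) : TreeAction G (Σ b, G ⧸ K b) :=
  treeActionOfIsTree (Γ := bassSerre K) ⟨h.connected, h.isAcyclic⟩
    (by
      rintro g _ _ ⟨b, g', rfl, rfl⟩
      exact ⟨b, g * g', rfl, rfl⟩)
    (by
      rintro g v ⟨b, g', rfl, h1⟩
      rw [smul_vert, vert_eq_iff] at h1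
      simpa using h1.1)
    (by
      rintro g _ _ _ ⟨b, g₁, rfl, rfl⟩ ⟨b', g₂, h1, rfl⟩ hne h2 h3 h4
      obtain ⟨rfl, h0⟩ := vert_eq_iff.1 h1
      rw [smul_vert, eq_comm] at h2 h3 h4
      have h2 := (vert_eq_iff.1 h2).2
      have h3 := (vert_eq_iff.1 h3).2
      have h4 := (vert_eq_iff.1 h4).2
      have hk : (g₁⁻¹ * g₂)⁻¹ ∉ A := fun hk =>
        hne (vert_eq_iff.2 ⟨rfl, h.le _ (by simpa using inv_mem hk)⟩)
      have h5 : g₂⁻¹ * (g * g₂) ∈ K b := by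
        have := mul_mem (mul_mem (inv_mem h0) h2) h0
        simpa [mul_assoc] using this
      have h6 := hA _ hk _ (h.mem_of_mem_of_mem h2 h3)
        (by simpa [mul_assoc] using h.mem_of_mem_of_mem h5 h4)
      rw [← mul_assoc] at h6
      simpa using conj_eq_one_iff (a := g₁⁻¹) (b := g) |>.1 (by simpa using h6))

/-- A two-generator subgroup is conjugate into a factor or generated by a ping-pong pair. -/
theorem exists_conj_or_hasPingPong (hA : IsMalnormal A) (x y : G) :
    (∃ b g, ∀ z ∈ Subgroup.closure {x, y}, g⁻¹ * z * g ∈ K b) ∨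
      HasPingPong (Σ b, G ⧸ K b) (Subgroup.closure {x, y}) := by
  have : Nonempty (Σ b, G ⧸ K b) := ⟨vert K true 1⟩
  refine ((h.treeAction hA).exists_fixed_or_hasPingPong x y).imp_left ?_
  rintro ⟨v, hv⟩
  obtain ⟨b, g, rfl⟩ := exists_eq_vert v
  refine ⟨b, g, fun z hz => ?_⟩
  have := hv z hz
  rw [smul_vert, eq_comm, vert_eq_iff] at this
  simpa [mul_assoc] using this.2

theorem twoGenFree (hA : IsMalnormal A) (hK : ∀ b, TwoGenFree (K b)) : TwoGenFree G := by
  intro x y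
  rcases h.exists_conj_or_hasPingPong hA x y with ⟨b, g, hg⟩ | hp
  · have hf : Function.Injective ((MulAut.conj g).toMonoidHom.comp (K b).subtype) :=
      (MulAut.conj g).injective.comp (K b).subtype_injective
    have mem : ∀ z ∈ Subgroup.closure {x, y},
        z ∈ ((MulAut.conj g).toMonoidHom.comp (K b).subtype).range := fun z hz =>
      ⟨⟨_, hg z hz⟩, by simp [mul_assoc]⟩
    exact (hK b).isFreeProductOfCyclics hf (mem _ (Subgroup.subset_closure (by simp)))
      (mem _ (Subgroup.subset_closure (by simp)))
  · exact hp.isFreeProductOfCyclics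

theorem closure_pair_ne_top (hA : IsMalnormal A) (hne : ∀ b, A ≠ K b)
    (hK : ∀ b, ¬ IsMulCommutative (K b)) (x y : G) : Subgroup.closure {x, y} ≠ ⊤ := by
  intro htop
  rcases h.exists_conj_or_hasPingPong hA x y with ⟨b, g, hg⟩ | ⟨x', y', p, hcl, hp⟩
  · rw [htop] at hg
    refine hne (!b) ((h.le _).antisymm fun k hk => h.mem_of_mem_of_mem (b := b) ?_ hk)
    simpa [mul_assoc] using hg (g * k * g⁻¹) trivial
  · obtain ⟨b, g, rfl⟩ := exists_eq_vert p
    refine hK b ⟨⟨fun k k' => ?_⟩⟩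
    have mem : ∀ k ∈ K b, g * k * g⁻¹ ∈ Subgroup.zpowers x' := fun k hk => by
      refine hp.mem_zpowers (by rw [hcl, htop]; trivial) ?_
      rw [smul_vert, vert_eq_iff]
      exact ⟨rfl, by simpa using hk⟩
    obtain ⟨i, hi⟩ := mem k k.2
    obtain ⟨j, hj⟩ := mem k' k'.2
    simp only at hi hj
    have h1 := (Commute.refl x').zpow_zpow i j
    rw [hi, hj] at h1
    have h2 := h1.eq
    ext
    exact mul_right_cancel (b := g⁻¹) (by simpa [mul_assoc] using h2)

end IsBipolar

end BassSerre

section Pushout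

open Monoid

variable {ι H : Type*} [Group H] {M : ι → Type*} [∀ i, Group (M i)] {φ : ∀ i, H →* M i}

/-- The elements of a pushout of groups represented by a reduced word whose first syllable comes
from `M i` and whose last syllable comes from `M j`. -/
inductive IsReducedProd (φ : ∀ i, H →* M i) : ι → ι → PushoutI φ → Prop
  | single (i : ι) {m : M i} (hm : m ∉ (φ i).range) : IsReducedProd φ i i (PushoutI.of i m)
  | snoc {i j : ι} (k : ι) {g : PushoutI φ} {m : M k} (hg : IsReducedProd φ i j g) (hjk : j ≠ k)
      (hm : m ∉ (φ k).range) : IsReducedProd φ i k (g * PushoutI.of k m)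

namespace IsReducedProd

variable {i i' j j' k : ι} {g : PushoutI φ}

theorem mul_base (hg : IsReducedProd φ i j g) (h : H) :
    IsReducedProd φ i j (g * PushoutI.base φ h) := by
  have key : ∀ (k : ι) {m : M k}, m ∉ (φ k).range → m * φ k h ∉ (φ k).range := fun k m hm hm' =>
    hm ((Subgroup.mul_mem_cancel_right _ (MonoidHom.mem_range.2 ⟨h, rfl⟩)).1 hm')
  cases hg with
  | single hm =>
    rw [← PushoutI.of_apply_eq_base φ i, ← map_mul]
    exact single _ (key i hm)
  | snoc _ hg hjk hm =>
    rw [mul_assoc, ← PushoutI.of_apply_eq_base φ j, ← map_mul]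
    exact snoc _ hg hjk (key j hm)

theorem mul_of_of_ne (hg : IsReducedProd φ i j g) (hik : i ≠ k) (m : M k) :
    ∃ j', IsReducedProd φ i j' (g * PushoutI.of k m) := by
  by_cases hm : m ∈ (φ k).range
  · obtain ⟨h, rfl⟩ := hm
    rw [PushoutI.of_apply_eq_base]
    exact ⟨j, hg.mul_base h⟩
  by_cases hjk : j = k
  · subst hjk
    cases hg with
    | single => exact absurd rfl hik
    | @snoc j' _ g m' hg hjk hm' =>
      rw [mul_assoc, ← map_mul]
      by_cases hmm : m' * m ∈ (φ j).range
      · obtain ⟨h, hh⟩ := hmm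
        rw [← hh, PushoutI.of_apply_eq_base]
        exact ⟨j', hg.mul_base h⟩
      · exact ⟨j, hg.snoc _ hjk hmm⟩
  · exact ⟨k, hg.snoc _ hjk hm⟩

theorem mul_of_self (hg : IsReducedProd φ i j g) (m : M i) :
    (∃ j', IsReducedProd φ i j' (g * PushoutI.of i m)) ∨
      g * PushoutI.of i m ∈ (PushoutI.base φ).range := by
  by_cases hm : m ∈ (φ i).range
  · obtain ⟨h, rfl⟩ := hm
    rw [PushoutI.of_apply_eq_base]
    exact Or.inl ⟨j, hg.mul_base h⟩
  by_cases hji : j = i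
  · subst hji
    cases hg with
    | @single m' hm' =>
      rw [← map_mul]
      by_cases hmm : m' * m ∈ (φ j).range
      · obtain ⟨h, hh⟩ := hmm
        rw [← hh, PushoutI.of_apply_eq_base]
        exact Or.inr ⟨h, rfl⟩
      · exact Or.inl ⟨j, single _ hmm⟩
    | @snoc j' _ g m' hg hjk hm' =>
      left
      rw [mul_assoc, ← map_mul]
      by_cases hmm : m' * m ∈ (φ j).range
      · obtain ⟨h, hh⟩ := hmm
        rw [← hh, PushoutI.of_apply_eq_base]
        exact ⟨j', hg.mul_base h⟩
      · exact ⟨j, hg.snoc _ hjk hmm⟩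
  · exact Or.inl ⟨i, hg.snoc _ hji hm⟩

theorem exists_neWord (hg : IsReducedProd φ i j g) :
    ∃ w : CoprodI.NeWord M i j, PushoutI.Reduced φ w.toWord ∧ PushoutI.ofCoprodI w.prod = g := by
  have ne_one : ∀ {k : ι} {m : M k}, m ∉ (φ k).range → m ≠ 1 := by
    rintro k m hm rfl
    exact hm (one_mem _)
  induction hg with
  | single hm =>
    refine ⟨.singleton _ (ne_one hm), ?_, by simp⟩
    simpa [PushoutI.Reduced, CoprodI.NeWord.toWord] using hm
  | snoc k hg hjk hm ih =>
    obtain ⟨w, hw, rfl⟩ := ih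
    refine ⟨w.append hjk (.singleton _ (ne_one hm)), ?_, by simp⟩
    intro x hx
    simp only [CoprodI.NeWord.toWord, CoprodI.NeWord.toList, List.mem_append,
      List.mem_singleton] at hx
    rcases hx with hx | rfl
    · exact hw x hx
    · exact hm

end IsReducedProd

theorem reduced_neWord_inv {i j : ι} {w : CoprodI.NeWord M i j} (hw : PushoutI.Reduced φ w.toWord) :
    PushoutI.Reduced φ w.inv.toWord := by
  induction w with
  | singleton x hx =>
    simp only [PushoutI.Reduced, CoprodI.NeWord.toWord, CoprodI.NeWord.toList,
      CoprodI.NeWord.inv, List.mem_singleton, forall_eq] at hw ⊢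
    rwa [inv_mem_iff]
  | append w₁ h w₂ ih₁ ih₂ =>
    intro x hx
    simp only [CoprodI.NeWord.toWord, CoprodI.NeWord.toList, CoprodI.NeWord.inv,
      List.mem_append] at hx
    rcases hx with hx | hx
    · exact ih₂ (fun y hy => hw y (List.mem_append_right _ hy)) x hx
    · exact ih₁ (fun y hy => hw y (List.mem_append_left _ hy)) x hx

theorem ofCoprodI_prod_notMem (hφ : ∀ i, Function.Injective (φ i)) {i j : ι}
    {w : CoprodI.NeWord M i j} (hw : PushoutI.Reduced φ w.toWord) :
    PushoutI.ofCoprodI w.prod ∉ (PushoutI.base φ).range := fun h =>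
  w.toList_ne_nil (congrArg CoprodI.Word.toList (hw.eq_empty_of_mem_range hφ h))

namespace IsReducedProd

variable {i i' j j' : ι} {g : PushoutI φ}

theorem notMem (hφ : ∀ i, Function.Injective (φ i)) (hg : IsReducedProd φ i j g) :
    g ∉ (PushoutI.base φ).range := by
  obtain ⟨w, hw, rfl⟩ := hg.exists_neWord
  exact ofCoprodI_prod_notMem hφ hw

theorem fst_unique (hφ : ∀ i, Function.Injective (φ i)) (hg : IsReducedProd φ i j g)
    (hg' : IsReducedProd φ i' j' g) : i = i' := by
  by_contra hii
  obtain ⟨w, hw, rfl⟩ := hg.exists_neWord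
  obtain ⟨w', hw', h⟩ := hg'.exists_neWord
  refine ofCoprodI_prod_notMem hφ (w := w.inv.append hii w') ?_ ?_
  · intro x hx
    rcases List.mem_append.1 hx with hx | hx
    · exact reduced_neWord_inv hw x hx
    · exact hw' x hx
  · rw [CoprodI.NeWord.append_prod, map_mul, h, CoprodI.NeWord.inv_prod, map_inv, inv_mul_cancel]
    exact one_mem _

end IsReducedProd

theorem iSup_range_of [Nonempty ι] : ⨆ i, (PushoutI.of i : M i →* PushoutI φ).range = ⊤ := by
  rw [eq_top_iff]
  rintro g -
  have hof : ∀ i, (PushoutI.of i : M i →* PushoutI φ).range ≤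
      ⨆ i, (PushoutI.of i : M i →* PushoutI φ).range := fun i => le_iSup (fun i =>
        (PushoutI.of i : M i →* PushoutI φ).range) i
  induction g using PushoutI.induction_on with
  | of i m => exact hof i ⟨m, rfl⟩
  | base h =>
    obtain ⟨i⟩ := ‹Nonempty ι›
    rw [← PushoutI.of_apply_eq_base φ i]
    exact hof i ⟨_, rfl⟩
  | mul g g' ih ih' => exact mul_mem ih ih'

end Pushout

section BoolPushout

open Monoid

variable {H : Type*} [Group H] {M : Bool → Type*} [∀ b, Group (M b)] {φ : ∀ b, H →* M b}

theorem isBipolar_pushout (hφ : ∀ b, Function.Injective (φ b)) :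
    IsBipolar (fun b => (PushoutI.of b : M b →* PushoutI φ).range) (PushoutI.base φ).range
      (fun b => {g | ∃ j, IsReducedProd φ b j g}) where
  le b := by
    rintro _ ⟨h, rfl⟩
    exact ⟨φ b h, PushoutI.of_apply_eq_base φ b h⟩
  gen := iSup_range_of
  disjoint b := by
    rintro ⟨j, hj⟩ ⟨j', hj'⟩
    simpa using hj.fst_unique hφ hj'
  notMem b := by
    rintro ⟨j, hj⟩
    exact hj.notMem hφ
  mul_mem_same b := by
    rintro ⟨j, hj⟩ ⟨m, rfl⟩
    exact hj.mul_of_self m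
  mul_mem_not b := by
    rintro ⟨j, hj⟩ ⟨m, rfl⟩
    exact hj.mul_of_of_ne (by simp) m
  mem_of_mem b := by
    rintro ⟨m, rfl⟩ hm
    refine ⟨b, .single b ?_⟩
    rintro ⟨h, rfl⟩
    exact hm ⟨h, (PushoutI.of_apply_eq_base φ b h).symm⟩

theorem twoGenFree_pushout (hφ : ∀ b, Function.Injective (φ b))
    (hA : IsMalnormal (PushoutI.base φ).range) (hM : ∀ b, TwoGenFree (M b)) :
    TwoGenFree (PushoutI φ) :=
  (isBipolar_pushout hφ).twoGenFree hA fun b =>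
    (hM b).of_injective (f := (MonoidHom.ofInjective (PushoutI.of_injective hφ b)).symm.toMonoidHom)
      (MulEquiv.injective _)

theorem closure_pair_ne_top_pushout {H : Type*} [CommGroup H] {φ : ∀ b, H →* M b}
    (hφ : ∀ b, Function.Injective (φ b))
    (hA : IsMalnormal (PushoutI.base φ).range) (hM : ∀ b, ∃ m m' : M b, m * m' ≠ m' * m)
    (x y : PushoutI φ) : Subgroup.closure {x, y} ≠ ⊤ := by
  have hK : ∀ b, ¬ IsMulCommutative (PushoutI.of b : M b →* PushoutI φ).range := by
    intro b hb
    obtain ⟨m, m', h⟩ := hM b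
    apply h
    have := hb.is_comm.comm ⟨PushoutI.of b m, m, rfl⟩ ⟨PushoutI.of b m', m', rfl⟩
    rw [Subtype.ext_iff] at this
    simpa only [Subgroup.coe_mul, ← map_mul, (PushoutI.of_injective hφ b).eq_iff] using this
  refine (isBipolar_pushout hφ).closure_pair_ne_top hA (fun b hb => hK b ?_) hK x y
  rw [← hb]
  infer_instance

theorem of_true_mul_of_false_ne (hφ : ∀ b, Function.Injective (φ b)) {m : M true} {m' : M false}
    (hm : m ∉ (φ true).range) (hm' : m' ∉ (φ false).range) :
    (PushoutI.of true m * PushoutI.of false m' : PushoutI φ) ≠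
      PushoutI.of false m' * PushoutI.of true m := by
  intro h
  have h1 := (IsReducedProd.single (φ := φ) true hm).snoc false (by simp) hm'
  have h2 := (IsReducedProd.single (φ := φ) false hm').snoc true (by simp) hm
  rw [← h] at h2
  simpa using h1.fst_unique hφ h2

end BoolPushout

section SplitCyclics

open Monoid

variable {κ : Type*} (e : κ → ℕ) (c : κ → Bool)

/-- The free product of the cyclic groups whose index has a given colour. -/
abbrev ColourFactor (b : Bool) : Type _ := PresentedGroup (cyclicRels fun k : {k // c k = b} => e k)

/-- The generator of `ColourFactor e c (c k)` with index `k`. -/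
def colourOf (k : κ) : ColourFactor e c (c k) := PresentedGroup.of ⟨k, rfl⟩

/-- The restriction to a colour factor of the homomorphism given by images of the generators. -/
def colourLift {G : Type*} [Group G] (f : κ → G) (h : ∀ k, f k ^ e k = 1) (b : Bool) :
    ColourFactor e c b →* G :=
  cyclicLift (fun k => f k) fun k => h k

@[simp]
theorem colourLift_colourOf {G : Type*} [Group G] (f : κ → G) (h : ∀ k, f k ^ e k = 1) (k : κ) :
    colourLift e c f h (c k) (colourOf e c k) = f k :=
  cyclicLift_of _ _ _

theorem colourOf_pow (k : κ) : colourOf e c k ^ e k = 1 :=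
  presentedGroup_of_pow (fun k' : {k' // c k' = c k} => e k') ⟨k, rfl⟩

variable {H : Type*} [Group H] {e c} in
/-- The homomorphism from a free product of cyclic groups to an amalgam of its colour factors. -/
def splitHom (φ : ∀ b, H →* ColourFactor e c b) :
    PresentedGroup (cyclicRels e) →* PushoutI φ :=
  cyclicLift (fun k => PushoutI.of (c k) (colourOf e c k)) fun k => by
    rw [← map_pow, colourOf_pow, map_one]

theorem splitHom_injective :
    Function.Injective (splitHom (fun _ => 1 : ∀ b, Unit →* ColourFactor e c b)) := by
  refine Function.LeftInverse.injective (g := PushoutI.lift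
    (colourLift e c PresentedGroup.of (presentedGroup_of_pow e)) 1 fun b => by
      rw [MonoidHom.comp_one]) ?_
  refine DFunLike.congr_fun (f := (PushoutI.lift
    (colourLift e c PresentedGroup.of (presentedGroup_of_pow e)) 1 fun b => by
      rw [MonoidHom.comp_one]).comp (splitHom _)) (g := MonoidHom.id _) ?_
  ext k
  simp [splitHom]

theorem one_injective_of_unit {G : Type*} [Group G] : Function.Injective (1 : Unit →* G) :=
  Function.injective_of_subsingleton _

variable {e} in
theorem presentedGroup_of_ne_one {k : κ} (hk : e k ≠ 1) :
    (PresentedGroup.of k : PresentedGroup (cyclicRels e)) ≠ 1 := by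
  classical
  intro h
  have h' := congrArg (cyclicLift (e := e)
    (fun i => if h : i = k then Multiplicative.ofAdd (1 : ZMod (e k)) else 1) fun i => by
      split_ifs with hi
      · subst hi
        rw [← ofAdd_nsmul, nsmul_one, ZMod.natCast_self, ofAdd_zero]
      · exact one_pow _) h
  have : Nontrivial (ZMod (e k)) := ZMod.nontrivial_iff.2 hk
  simp at h'

theorem exists_not_commute {k₀ k₁ : κ} (hk : k₀ ≠ k₁) (h₀ : e k₀ ≠ 1) (h₁ : e k₁ ≠ 1) :
    ∃ m m' : PresentedGroup (cyclicRels e), m * m' ≠ m' * m := by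
  classical
  refine ⟨PresentedGroup.of k₀, PresentedGroup.of k₁, fun h => ?_⟩
  have key : ∀ b, ∀ m : ColourFactor e (fun k => decide (k = k₀)) b, m ≠ 1 →
    m ∉ (1 : Unit →* ColourFactor e (fun k => decide (k = k₀)) b).range := by
      rintro b m hm ⟨_, rfl⟩
      exact hm rfl
  have h' := congrArg (splitHom (fun _ => 1 : ∀ b, Unit →* ColourFactor e
    (fun k => decide (k = k₀)) b)) h
  have heq : ∀ (b : Bool) (k : κ) (hb : decide (k = k₀) = b),
      splitHom (fun _ => 1 : ∀ b, Unit →* ColourFactor e (fun k => decide (k = k₀)) b)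
        (PresentedGroup.of k) = PushoutI.of b (PresentedGroup.of ⟨k, hb⟩) := by
    rintro _ k rfl
    exact cyclicLift_of _ _ _
  rw [map_mul, map_mul, heq true k₀ (by simp), heq false k₁ (by simpa using hk.symm)] at h'
  exact of_true_mul_of_false_ne (fun _ => one_injective_of_unit)
    (key _ _ (presentedGroup_of_ne_one h₀)) (key _ _ (presentedGroup_of_ne_one h₁)) h'

theorem isMalnormal_bot {G : Type*} [Group G] : IsMalnormal (⊥ : Subgroup G) :=
  fun _ _ _ hx _ => hx

theorem twoGenFree_of_card_le (n : ℕ) : ∀ (κ : Type*) [Finite κ] (e : κ → ℕ), Nat.card κ ≤ n →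
    TwoGenFree (PresentedGroup (cyclicRels e)) := by
  classical
  induction n with
  | zero =>
    intro κ _ e h
    have : IsEmpty κ := Finite.card_eq_zero_iff.1 (Nat.le_zero.1 h)
    have : Subsingleton (PresentedGroup (cyclicRels e)) :=
      (QuotientGroup.mk_surjective).subsingleton
    exact twoGenFree_of_isCyclic
  | succ n ih =>
    intro κ _ e h
    rcases subsingleton_or_nontrivial κ with hκ | ⟨k₀, k₁, hk⟩
    · have : IsCyclic (PresentedGroup (cyclicRels e)) := by
        rcases isEmpty_or_nonempty κ with hκ' | ⟨⟨k⟩⟩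
        · have : Subsingleton (PresentedGroup (cyclicRels e)) :=
            (QuotientGroup.mk_surjective).subsingleton
          infer_instance
        · refine ⟨PresentedGroup.of k, fun g => ?_⟩
          have hg : g ∈ Subgroup.closure (Set.range PresentedGroup.of) := by
            rw [PresentedGroup.closure_range_of]; trivial
          have hr : Set.range (PresentedGroup.of (rels := cyclicRels e)) =
              {PresentedGroup.of k} := by
            ext z
            simpa [Subsingleton.elim _ k, eq_comm] using fun _ => ⟨k⟩
          rwa [hr, ← Subgroup.zpowers_eq_closure] at hg
      exact twoGenFree_of_isCyclic
    · refine TwoGenFree.of_injective ?_ (splitHom_injective e fun k => decide (k = k₀))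
      refine twoGenFree_pushout (fun _ => one_injective_of_unit) ?_ fun b => ih _ _ ?_
      · have : (PushoutI.base (fun _ => 1 : ∀ b, Unit →* ColourFactor e
            (fun k => decide (k = k₀)) b)).range = ⊥ := by
          rw [eq_bot_iff]
          rintro _ ⟨u, rfl⟩
          exact map_one _
        rw [this]
        exact isMalnormal_bot
      · refine Nat.le_of_lt_succ (lt_of_lt_of_le (Finite.card_subtype_lt (x := bif b then k₁ else k₀) ?_) h)
        cases b <;> simp [hk.symm]

theorem twoGenFree_presentedGroup [Finite κ] : TwoGenFree (PresentedGroup (cyclicRels e)) :=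
  twoGenFree_of_card_le _ κ e le_rfl

end SplitCyclics

section Retract

variable {κ G : Type*} [Group G]

theorem freeGroup_hom_congr [DecidableEq κ] {f g : FreeGroup κ →* G} {w : FreeGroup κ}
    (h : ∀ x ∈ w.toWord, f (FreeGroup.of x.1) = g (FreeGroup.of x.1)) : f w = g w := by
  rw [← FreeGroup.mk_toWord (x := w)]
  generalize w.toWord = L at h
  induction L with
  | nil => rw [← FreeGroup.one_eq_mk, map_one, map_one]
  | cons x L ih =>
    have hx : (FreeGroup.mk (x :: L)) = FreeGroup.mk [x] * FreeGroup.mk L := by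
      rw [FreeGroup.mul_mk]; rfl
    rw [hx, map_mul, map_mul, ih fun y hy => h y (List.mem_cons_of_mem _ hy)]
    congr 1
    have h1 := h x List.mem_cons_self
    obtain ⟨i, _ | _⟩ := x
    · have : FreeGroup.mk [(i, false)] = (FreeGroup.of i)⁻¹ := rfl
      rw [this, map_inv, map_inv, h1]
    · exact h1

variable (e : κ → ℕ) (c : κ → Bool)

/-- The homomorphism onto a colour factor killing the generators of the other colour. -/
def retract (b : Bool) : FreeGroup κ →* ColourFactor e c b :=
  FreeGroup.lift fun k => if h : c k = b then PresentedGroup.of ⟨k, h⟩ else 1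

@[simp]
theorem retract_of (k : κ) : retract e c (c k) (FreeGroup.of k) = colourOf e c k := by
  simp [retract, colourOf]

variable {e c} in
theorem comp_retract_apply [DecidableEq κ] {b : Bool} {w : FreeGroup κ}
    (hw : ∀ x ∈ w.toWord, c x.1 = b) {F : FreeGroup κ →* G} {f : ∀ b, ColourFactor e c b →* G}
    (hF : ∀ k, f (c k) (colourOf e c k) = F (FreeGroup.of k)) : f b (retract e c b w) = F w := by
  refine freeGroup_hom_congr (f := (f b).comp (retract e c b)) fun x hx => ?_
  obtain rfl := hw x hx
  simp [hF]

end Retract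

theorem IsMalnormal.isOfFinOrder_pow {G : Type*} [Group G] {a : G} {m : ℕ} (hm : 2 ≤ m)
    (h : IsMalnormal (Subgroup.zpowers (a ^ m))) : IsOfFinOrder (a ^ m) := by
  by_cases ha : a ∈ Subgroup.zpowers (a ^ m)
  · obtain ⟨k, hk⟩ := ha
    refine IsOfFinOrder.pow (isOfFinOrder_iff_zpow_eq_one.2 ⟨m * k - 1, ?_, ?_⟩)
    · intro h0
      have : (m : ℤ) ∣ 1 := ⟨k, by linarith⟩
      have := Int.le_of_dvd one_pos this
      omega
    · rw [zpow_sub_one, zpow_mul, zpow_natCast]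
      simpa using mul_inv_eq_one.2 hk
  · have := h a ha (a ^ m) (Subgroup.mem_zpowers _) (by
      rw [← pow_succ', pow_succ, mul_inv_cancel_right]
      exact Subgroup.mem_zpowers _)
    rw [this]
    exact IsOfFinOrder.one

theorem IsMalnormal.map_mulEquiv {G G' : Type*} [Group G] [Group G'] {A : Subgroup G}
    (h : IsMalnormal A) (f : G ≃* G') : IsMalnormal (A.map f.toMonoidHom) := by
  rintro g hg _ ⟨x, hx, rfl⟩ hgx
  obtain ⟨g, rfl⟩ := f.surjective g
  obtain ⟨y, hy, hxy⟩ := hgx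
  have hxy : y = g * x * g⁻¹ := f.injective (by simpa using hxy)
  have : x = 1 := h g (fun h' => hg ⟨g, h', rfl⟩) x hx (hxy ▸ hy)
  simp [this]

namespace FTypeBase

open Monoid

variable (D : FTypeBase)

/-- Whether a generator belongs to the first factor. -/
def inFst (i : Fin D.n) : Bool := decide ((i : ℕ) < D.p)

/-- The generator of the amalgamated subgroup, as an element of either factor. -/
def root : ∀ b, ColourFactor D.e D.inFst b
  | true => retract D.e D.inFst true D.U
  | false => (retract D.e D.inFst false D.V)⁻¹

/-- The inclusions of the amalgamated subgroup in the factors. -/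
def rootHom (b : Bool) : Multiplicative ℤ →* ColourFactor D.e D.inFst b :=
  zpowersHom _ (D.root b)

theorem of_pow_eq_one (i : Fin D.n) : (PresentedGroup.of i : D.Gp) ^ D.e i = 1 :=
  PresentedGroup.one_of_mem (rels := D.rels) (Or.inl ⟨i, rfl⟩)

theorem of_pow_eq_one1 (i : Fin D.n) : (PresentedGroup.of i : D.Gp1) ^ D.e i = 1 := by
  rcases lt_or_ge (i : ℕ) D.p with h | h
  · exact PresentedGroup.one_of_mem (rels := D.rels1) (Or.inl ⟨i, h, rfl⟩)
  · have : (PresentedGroup.of i : D.Gp1) = 1 :=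
      PresentedGroup.one_of_mem (rels := D.rels1) (Or.inr ⟨i, h, rfl⟩)
    rw [this, one_pow]

theorem of_pow_eq_one2 (i : Fin D.n) : (PresentedGroup.of i : D.Gp2) ^ D.e i = 1 := by
  rcases lt_or_ge (i : ℕ) D.p with h | h
  · have : (PresentedGroup.of i : D.Gp2) = 1 :=
      PresentedGroup.one_of_mem (rels := D.rels2) (Or.inr ⟨i, h, rfl⟩)
    rw [this, one_pow]
  · exact PresentedGroup.one_of_mem (rels := D.rels2) (Or.inl ⟨i, h, rfl⟩)

theorem mk_U_mul_mk_V : PresentedGroup.mk D.rels D.U * PresentedGroup.mk D.rels D.V = 1 := by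
  rw [← map_mul]
  exact PresentedGroup.one_of_mem (rels := D.rels) (Or.inr rfl)

variable {D}

theorem colourLift_retract {rels : Set (FreeGroup (Fin D.n))}
    (h : ∀ i, (PresentedGroup.of i : PresentedGroup rels) ^ D.e i = 1) {b : Bool}
    {w : FreeGroup (Fin D.n)} (hw : ∀ x ∈ w.toWord, D.inFst x.1 = b) :
    colourLift D.e D.inFst PresentedGroup.of h b (retract D.e D.inFst b w) =
      PresentedGroup.mk rels w :=
  comp_retract_apply hw fun _ => colourLift_colourOf ..

namespace IsFType

variable (hD : D.IsFType)

include hD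

theorem inFst_U : ∀ x ∈ D.U.toWord, D.inFst x.1 = true := fun x hx =>
  decide_eq_true (hD.2.2.2.2.1 x hx)

theorem inFst_V : ∀ x ∈ D.V.toWord, D.inFst x.1 = false := fun x hx =>
  decide_eq_false (hD.2.2.2.2.2.1 x hx).not_gt

theorem not_isOfFinOrder_root (b : Bool) : ¬ IsOfFinOrder (D.root b) := by
  intro h
  cases b with
  | true =>
    have := (colourLift D.e D.inFst PresentedGroup.of D.of_pow_eq_one1 true).isOfFinOrder h
    rw [root, colourLift_retract _ hD.inFst_U] at this
    exact hD.2.2.2.2.2.2.2.2.1 this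
  | false =>
    have := (colourLift D.e D.inFst PresentedGroup.of D.of_pow_eq_one2 false).isOfFinOrder
      (isOfFinOrder_inv_iff.1 h)
    rw [colourLift_retract _ hD.inFst_V] at this
    exact hD.2.2.2.2.2.2.2.2.2.1 this

theorem rootHom_injective (b : Bool) : Function.Injective (D.rootHom b) :=
  (injective_zpow_iff_not_isOfFinOrder.2 (hD.not_isOfFinOrder_root b)).comp
    Multiplicative.toAdd.injective

theorem colourLift_root (b : Bool) :
    colourLift D.e D.inFst PresentedGroup.of D.of_pow_eq_one b (D.root b) =
      PresentedGroup.mk D.rels D.U := by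
  cases b with
  | true => exact colourLift_retract _ hD.inFst_U
  | false =>
    rw [root, map_inv, colourLift_retract _ hD.inFst_V]
    exact (eq_inv_of_mul_eq_one_left D.mk_U_mul_mk_V).symm

/-- The natural homomorphism from an F-type group to the amalgam of its factors. -/
def toPushout : D.Gp →* PushoutI D.rootHom :=
  PresentedGroup.toGroup (f := fun i => PushoutI.of (D.inFst i) (colourOf D.e D.inFst i)) <| by
    rintro _ (⟨i, rfl⟩ | rfl)
    · rw [map_pow, FreeGroup.lift_apply_of, ← map_pow, colourOf_pow, map_one]
    · rw [map_mul, ← comp_retract_apply (f := fun b => PushoutI.of b) hD.inFst_U fun k => by simp,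
        ← comp_retract_apply (f := fun b => PushoutI.of b) hD.inFst_V fun k => by simp]
      have h1 := PushoutI.of_apply_eq_base D.rootHom true (Multiplicative.ofAdd 1)
      have h2 := PushoutI.of_apply_eq_base D.rootHom false (Multiplicative.ofAdd 1)
      simp only [rootHom, root, zpowersHom_apply, toAdd_ofAdd, zpow_one, map_inv] at h1 h2
      rw [h1, ← h2, inv_mul_cancel]

/-- The natural homomorphism to an F-type group from the amalgam of its factors. -/
def ofPushout : PushoutI D.rootHom →* D.Gp :=
  PushoutI.lift (colourLift D.e D.inFst PresentedGroup.of D.of_pow_eq_one)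
    (zpowersHom _ (PresentedGroup.mk D.rels D.U)) fun b => by
      ext
      simp [rootHom, hD.colourLift_root]

/-- An F-type group is the amalgam of its factors. -/
def mulEquivPushout : D.Gp ≃* PushoutI D.rootHom :=
  MonoidHom.toMulEquiv hD.toPushout hD.ofPushout
    (by ext i; simp [toPushout, ofPushout])
    (by
      refine PushoutI.hom_ext_nonempty fun b => ?_
      ext ⟨k, rfl⟩
      have := colourLift_colourOf D.e D.inFst PresentedGroup.of D.of_pow_eq_one k
      rw [colourOf] at this
      simp [toPushout, ofPushout, this, colourOf])

theorem mulEquivPushout_symm_root (b : Bool) :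
    hD.mulEquivPushout.symm (PushoutI.of b (D.root b)) = PresentedGroup.mk D.rels D.U := by
  change hD.ofPushout (PushoutI.of b (D.root b)) = _
  rw [ofPushout, PushoutI.lift_of, hD.colourLift_root]

theorem map_amalg :
    D.amalg.map hD.mulEquivPushout.toMonoidHom = (PushoutI.base D.rootHom).range := by
  have h1 : hD.mulEquivPushout (PresentedGroup.mk D.rels D.U) =
      PushoutI.base D.rootHom (Multiplicative.ofAdd 1) := by
    rw [← hD.mulEquivPushout_symm_root true, MulEquiv.apply_symm_apply,
      ← PushoutI.of_apply_eq_base D.rootHom true]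
    simp [rootHom]
  rw [amalg, MonoidHom.map_zpowers]
  refine (congrArg Subgroup.zpowers h1).trans ?_
  rw [← MonoidHom.map_zpowers, MonoidHom.range_eq_map]
  congr 1
  exact eq_top_iff.2 fun k _ => ⟨k.toAdd, by simp [← ofAdd_zsmul]⟩

theorem not_isOfFinOrder_U : ¬ IsOfFinOrder (PresentedGroup.mk D.rels D.U) := by
  intro h
  rw [← hD.mulEquivPushout_symm_root true] at h
  refine hD.not_isOfFinOrder_root true ?_
  rwa [← (PushoutI.of_injective hD.rootHom_injective true).isOfFinOrder_iff,
    ← hD.mulEquivPushout.symm.injective.isOfFinOrder_iff]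

theorem exists_not_commute (hmal : IsMalnormal D.amalg) (b : Bool) :
    ∃ m m' : ColourFactor D.e D.inFst b, m * m' ≠ m' * m := by
  have he : ∀ i, D.e i ≠ 1 := fun i => by have := hD.2.1 i; omega
  have hn := hD.1
  have hp := hD.2.2.1
  have hp' := hD.2.2.2.1
  have key : ∀ i j : Fin D.n, i ≠ j → D.inFst i = b → D.inFst j = b →
      ∃ m m' : ColourFactor D.e D.inFst b, m * m' ≠ m' * m := fun i j hij hi hj =>
    FPaper.exists_not_commute (fun k : {k // D.inFst k = b} => D.e k) (k₀ := ⟨i, hi⟩)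
      (k₁ := ⟨j, hj⟩) (by simpa using hij) (he i) (he j)
  cases b with
  | true =>
    have hp1 : D.p ≠ 1 := by
      intro h
      obtain ⟨i, m, -, hm, hU⟩ := hD.2.2.2.2.2.2.2.2.2.2.1 h
      apply hD.not_isOfFinOrder_U
      rw [amalg, hU, map_pow] at hmal
      rw [hU, map_pow]
      exact hmal.isOfFinOrder_pow hm
    exact key ⟨0, by omega⟩ ⟨1, by omega⟩ (by simp) (decide_eq_true (by simp; omega))
      (decide_eq_true (by simp; omega))
  | false =>
    have hp1 : D.p ≠ D.n - 1 := by
      intro h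
      obtain ⟨i, m, -, hm, hV⟩ := hD.2.2.2.2.2.2.2.2.2.2.2 h
      apply hD.not_isOfFinOrder_U
      rw [amalg, eq_inv_of_mul_eq_one_left D.mk_U_mul_mk_V, Subgroup.zpowers_inv, hV, map_pow]
        at hmal
      rw [eq_inv_of_mul_eq_one_left D.mk_U_mul_mk_V, isOfFinOrder_inv_iff, hV, map_pow]
      exact hmal.isOfFinOrder_pow hm
    exact key ⟨D.p, by omega⟩ ⟨D.p + 1, by omega⟩ (by simp) (decide_eq_false (by simp))
      (decide_eq_false (by simp))

end IsFType

end FTypeBase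

/-- If the amalgamated subgroup `⟨U⟩ = ⟨V⟩` of a group of F-type is malnormal,
then every two-generator subgroup is a free product of cyclic groups, and the group cannot be
generated by two elements (its rank is at least `3`). -/
theorem fType_malnormal_two_generator (D : FTypeBase) (hD : D.IsFType)
    (hmal : IsMalnormal D.amalg) :
    (∀ x y : D.Gp, IsFreeProductOfCyclics (Subgroup.closure {x, y})) ∧
    (∀ x y : D.Gp, Subgroup.closure {x, y} ≠ (⊤ : Subgroup D.Gp)) := by
  have hA := hmal.map_mulEquiv hD.mulEquivPushout
  rw [hD.map_amalg] at hA
  refine ⟨(twoGenFree_pushout hD.rootHom_injective hA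
    fun b => twoGenFree_presentedGroup _).of_injective
    (f := hD.mulEquivPushout.toMonoidHom) hD.mulEquivPushout.injective, fun x y h => ?_⟩
  refine closure_pair_ne_top_pushout hD.rootHom_injective hA (hD.exists_not_commute hmal)
    (hD.mulEquivPushout x) (hD.mulEquivPushout y) ?_
  have := closure_pair_map hD.mulEquivPushout.toMonoidHom x y
  rw [h] at this
  exact this.symm.trans (Subgroup.map_top_of_surjective _ hD.mulEquivPushout.surjective)

end FPaper
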